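/- arXiv:1808.06944 — 8 statements merged into one kernel-verified Lean document; each statement's English description precedes it below -/
import Mathlib

section
/- Let the monotone-with-respect-to-inputs system (X, U, φ) satisfy: (i) there exists ρ of class K∞ such that for all x₋, x, x₊ ∈ X with x₋ ≤ x ≤ x₊ one has ‖x‖_X ≤ ρ(‖x₋‖_X + ‖x₊‖_X); and (ii) there exists η of class K∞ such that for every u ∈ U there exist u₋, u₊ ∈ U_c with u₋ ≤ u ≤ u₊, ‖u₋‖_U ≤ η(‖u‖_U) and ‖u₊‖_U ≤ η(‖u‖_U). Then the system is ISS with respect to all inputs in U if and only if it is ISS with respect to inputs in U_c. -/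
open Filter Set

/-- `γ` is of class `K`: continuous, strictly increasing on `[0,∞)` with `γ(0) = 0`. -/
def ClassK (γ : ℝ → ℝ) : Prop :=
  ContinuousOn γ (Ici 0) ∧ StrictMonoOn γ (Ici 0) ∧ γ 0 = 0

/-- `γ` is of class `K∞`: of class `K` and unbounded. -/
def ClassKInf (γ : ℝ → ℝ) : Prop :=
  ClassK γ ∧ Tendsto γ atTop atTop

/-- `β` is of class `KL`: continuous, `β(·,t)` of class `K` for every `t ≥ 0`, and for every
`r > 0` the map `β(r,·)` is strictly decreasing to `0` at infinity. -/
def ClassKL (β : ℝ → ℝ → ℝ) : Prop :=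
  ContinuousOn (fun q : ℝ × ℝ => β q.1 q.2) (Ici 0 ×ˢ Ici 0) ∧
  (∀ t ≥ (0:ℝ), ClassK fun r => β r t) ∧
  (∀ r > (0:ℝ), StrictAntiOn (fun t => β r t) (Ici 0) ∧
    Tendsto (fun t => β r t) atTop (nhds 0))

/-- `K` is a positive cone: `K ∩ (−K) = {0}`, and `K` is closed under addition and
multiplication by nonnegative reals. -/
def IsPositiveCone {V : Type*} [AddCommGroup V] [Module ℝ V] (K : Set V) : Prop :=
  K ∩ (-K) = {0} ∧
  (∀ a : ℝ, 0 ≤ a → ∀ x ∈ K, a • x ∈ K) ∧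
  (∀ x ∈ K, ∀ y ∈ K, x + y ∈ K)

/-- The partial order induced by a cone `K`: `x ≤ y` iff `y − x ∈ K`. -/
def coneLE {V : Type*} [AddCommGroup V] (K : Set V) (x y : V) : Prop := y - x ∈ K

/-- ISS with respect to inputs in `S`. -/
def ISSwrt {X U : Type*} [NormedAddCommGroup X] [NormedAddCommGroup U]
    (φ : ℝ → X → U → X) (S : Set U) : Prop :=
  ∃ β γ : _, ClassKL β ∧ ClassK γ ∧
    ∀ x : X, ∀ u ∈ S, ∀ t ≥ (0:ℝ), ‖φ t x u‖ ≤ β ‖x‖ t + γ ‖u‖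

theorem ClassK.nonneg' {γ : ℝ → ℝ} (h : ClassK γ) {r : ℝ} (hr : 0 ≤ r) : 0 ≤ γ r := by
  have := h.2.1.monotoneOn (mem_Ici.2 le_rfl) (mem_Ici.2 hr) hr
  rwa [h.2.2] at this

theorem ClassK.comp' {γ δ : ℝ → ℝ} (h : ClassK γ) (g : ClassK δ) :
    ClassK (fun r => γ (δ r)) := by
  have hm : MapsTo δ (Ici 0) (Ici 0) := fun r hr => g.nonneg' hr
  refine ⟨h.1.comp g.1 hm, h.2.1.comp g.2.1 hm, ?_⟩
  simp only [g.2.2, h.2.2]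

theorem ClassK.four : ClassK (fun r : ℝ => 4 * r) := by
  refine ⟨by fun_prop, ?_, by simp⟩
  intro a _ b _ hab
  simp only
  linarith

theorem ClassKL.comp' {γ : ℝ → ℝ} {β : ℝ → ℝ → ℝ} (h : ClassK γ) (g : ClassKL β) :
    ClassKL (fun r t => γ (β r t)) := by
  obtain ⟨g1, g2, g3⟩ := g
  refine ⟨h.1.comp g1 ?_, fun t ht => h.comp' (g2 t ht), fun r hr => ⟨?_, ?_⟩⟩
  · rintro ⟨r, t⟩ ⟨hr, ht⟩
    exact (g2 t ht).nonneg' hr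
  · intro a ha b hb hab
    exact h.2.1 ((g2 b hb).nonneg' hr.le) ((g2 a ha).nonneg' hr.le) ((g3 r hr).1 ha hb hab)
  · have hc : Tendsto γ (nhdsWithin 0 (Ici 0)) (nhds 0) := by
      have := h.1 0 (mem_Ici.2 le_rfl)
      rwa [ContinuousWithinAt, h.2.2] at this
    refine hc.comp (tendsto_nhdsWithin_iff.2 ⟨(g3 r hr).2, ?_⟩)
    filter_upwards [eventually_ge_atTop (0:ℝ)] with t ht
    exact (g2 t ht).nonneg' hr.le

theorem ClassK.add_le' {γ : ℝ → ℝ} (h : ClassK γ) {a b : ℝ} (ha : 0 ≤ a) (hb : 0 ≤ b) :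
    γ (2 * (a + b)) ≤ γ (4 * a) + γ (4 * b) := by
  have h1 := h.nonneg' (show 0 ≤ 4 * a by linarith)
  have h2 := h.nonneg' (show 0 ≤ 4 * b by linarith)
  rcases le_total a b with hab | hab
  · have := h.2.1.monotoneOn (mem_Ici.2 (show 0 ≤ 2 * (a + b) by linarith))
      (mem_Ici.2 (show 0 ≤ 4 * b by linarith)) (by linarith)
    linarith
  · have := h.2.1.monotoneOn (mem_Ici.2 (show 0 ≤ 2 * (a + b) by linarith))
      (mem_Ici.2 (show 0 ≤ 4 * a by linarith)) (by linarith)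
    linarith

/-- A system monotone w.r.t. inputs, with the sandwich property (i) on states
and property (ii) producing constant-like bounding inputs in `Uc`, is ISS iff it is ISS w.r.t.
inputs in `Uc`. -/
theorem stmt0 {X U : Type*}
    [NormedAddCommGroup X] [NormedSpace ℝ X]
    [NormedAddCommGroup U] [NormedSpace ℝ U]
    (KX : Set X) (KU : Set U)
    (hKX : IsPositiveCone KX) (hKU : IsPositiveCone KU)
    (Uc : Set U)
    (φ : ℝ → X → U → X)
    (hmono : ∀ t ≥ (0:ℝ), ∀ (x : X) (u₁ u₂ : U),
      coneLE KU u₁ u₂ → coneLE KX (φ t x u₁) (φ t x u₂))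
    (ρ : ℝ → ℝ) (hρ : ClassKInf ρ)
    (hsandwich : ∀ xm x xp : X, coneLE KX xm x → coneLE KX x xp →
      ‖x‖ ≤ ρ (‖xm‖ + ‖xp‖))
    (η : ℝ → ℝ) (hη : ClassKInf η)
    (hinput : ∀ u : U, ∃ um ∈ Uc, ∃ up ∈ Uc,
      coneLE KU um u ∧ coneLE KU u up ∧ ‖um‖ ≤ η ‖u‖ ∧ ‖up‖ ≤ η ‖u‖) :
    ISSwrt φ (univ : Set U) ↔ ISSwrt φ Uc := by
  constructor
  · rintro ⟨β, γ, hβ, hγ, H⟩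
    exact ⟨β, γ, hβ, hγ, fun x u _ => H x u (mem_univ u)⟩
  · rintro ⟨β, γ, hβ, hγ, H⟩
    have hρ4 := hρ.1.comp' ClassK.four
    refine ⟨_, _, ClassKL.comp' hρ4 hβ, hρ4.comp' (hγ.comp' hη.1), ?_⟩
    intro x u _ t ht
    obtain ⟨um, hum, up, hup, h1, h2, h3, h4⟩ := hinput u
    have hηu := hη.1.nonneg' (norm_nonneg u)
    have e1 := hγ.2.1.monotoneOn (mem_Ici.2 (norm_nonneg um)) (mem_Ici.2 hηu) h3
    have e2 := hγ.2.1.monotoneOn (mem_Ici.2 (norm_nonneg up)) (mem_Ici.2 hηu) h4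
    have hb := (hβ.2.1 t ht).nonneg' (norm_nonneg x)
    have hg := hγ.nonneg' hηu
    have f1 := H x um hum t ht
    have f2 := H x up hup t ht
    have h5 := hsandwich _ _ _ (hmono t ht x um u h1) (hmono t ht x u up h2)
    refine h5.trans (le_trans ?_ (hρ.1.add_le' hb hg))
    have hs : 0 ≤ ‖φ t x um‖ + ‖φ t x up‖ := by positivity
    refine hρ.1.2.1.monotoneOn (mem_Ici.2 hs) (mem_Ici.2 ?_) ?_ <;> linarith
end

section
/- Let the monotone-with-respect-to-inputs system (X, U, φ) satisfy: (i) there exists a linear function ρ(r) = C·r with C > 0 such that for all x₋, x, x₊ ∈ X with x₋ ≤ x ≤ x₊ one has ‖x‖_X ≤ ρ(‖x₋‖_X + ‖x₊‖_X); and (ii) there exists η of class K∞ such that for every u ∈ U there exist u₋, u₊ ∈ U_c with u₋ ≤ u ≤ u₊, ‖u₋‖_U ≤ η(‖u‖_U) and ‖u₊‖_U ≤ η(‖u‖_U). Then the system is exp-ISS with respect to all inputs in U if and only if it is exp-ISS with respect to inputs in U_c. -/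
open Filter Set

/-- exp-ISS with respect to inputs in `S`. -/
def ExpISSwrt {X U : Type*} [NormedAddCommGroup X] [NormedAddCommGroup U]
    (φ : ℝ → X → U → X) (S : Set U) : Prop :=
  ∃ M > (0:ℝ), ∃ a > (0:ℝ), ∃ γ : ℝ → ℝ, ClassKInf γ ∧
    ∀ x : X, ∀ u ∈ S, ∀ t ≥ (0:ℝ),
      ‖φ t x u‖ ≤ M * Real.exp (-a * t) * ‖x‖ + γ ‖u‖

/-- A system monotone w.r.t. inputs, with a *linear* sandwich bound (i) on
states and property (ii) producing bounding inputs in `Uc`, is exp-ISS iff it is exp-ISS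
w.r.t. inputs in `Uc`. -/
theorem stmt1 {X U : Type*}
    [NormedAddCommGroup X] [NormedSpace ℝ X]
    [NormedAddCommGroup U] [NormedSpace ℝ U]
    (KX : Set X) (KU : Set U)
    (hKX : IsPositiveCone KX) (hKU : IsPositiveCone KU)
    (Uc : Set U)
    (φ : ℝ → X → U → X)
    (hmono : ∀ t ≥ (0:ℝ), ∀ (x : X) (u₁ u₂ : U),
      coneLE KU u₁ u₂ → coneLE KX (φ t x u₁) (φ t x u₂))
    (C : ℝ) (hC : 0 < C)
    (hsandwich : ∀ xm x xp : X, coneLE KX xm x → coneLE KX x xp →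
      ‖x‖ ≤ C * (‖xm‖ + ‖xp‖))
    (η : ℝ → ℝ) (hη : ClassKInf η)
    (hinput : ∀ u : U, ∃ um ∈ Uc, ∃ up ∈ Uc,
      coneLE KU um u ∧ coneLE KU u up ∧ ‖um‖ ≤ η ‖u‖ ∧ ‖up‖ ≤ η ‖u‖) :
    ExpISSwrt φ (univ : Set U) ↔ ExpISSwrt φ Uc := by
  constructor
  · rintro ⟨M, hM, a, ha, γ, hγ, h⟩
    exact ⟨M, hM, a, ha, γ, hγ, fun x u _ t ht => h x u (mem_univ u) t ht⟩
  · rintro ⟨M, hM, a, ha, γ, ⟨⟨hγc, hγm, hγ0⟩, hγt⟩, h⟩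
    obtain ⟨⟨hηc, hηm, hη0⟩, hηt⟩ := hη
    have hmaps : MapsTo η (Ici 0) (Ici 0) := by
      intro r hr
      have := hηm.monotoneOn (mem_Ici.2 le_rfl) hr hr
      rw [hη0] at this
      exact this
    have h2C : 0 < 2 * C := by positivity
    refine ⟨2 * C * M, by positivity, a, ha, fun r => 2 * C * γ (η r),
      ⟨⟨continuousOn_const.mul (hγc.comp hηc hmaps), ?_, ?_⟩, ?_⟩, ?_⟩
    · intro r hr s hs hrs
      exact mul_lt_mul_of_pos_left (hγm (hmaps hr) (hmaps hs) (hηm hr hs hrs)) h2C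
    · simp [hη0, hγ0]
    · exact (hγt.comp hηt).const_mul_atTop h2C
    · intro x u _ t ht
      obtain ⟨um, hum, up, hup, hle1, hle2, hn1, hn2⟩ := hinput u
      have hs := hsandwich _ _ _ (hmono t ht x um u hle1) (hmono t ht x u up hle2)
      have h1 := h x um hum t ht
      have h2 := h x up hup t ht
      have hu : η ‖u‖ ∈ Ici (0 : ℝ) := hmaps (mem_Ici.2 (norm_nonneg u))
      have g1 := hγm.monotoneOn (mem_Ici.2 (norm_nonneg um)) hu hn1
      have g2 := hγm.monotoneOn (mem_Ici.2 (norm_nonneg up)) hu hn2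
      calc ‖φ t x u‖ ≤ C * (‖φ t x um‖ + ‖φ t x up‖) := hs
        _ ≤ C * ((M * Real.exp (-a * t) * ‖x‖ + γ (η ‖u‖)) +
              (M * Real.exp (-a * t) * ‖x‖ + γ (η ‖u‖))) :=
            mul_le_mul_of_nonneg_left (by linarith) hC.le
        _ = 2 * C * M * Real.exp (-a * t) * ‖x‖ + 2 * C * γ (η ‖u‖) := by ring
end

section
/- Let the monotone-with-respect-to-inputs system (X, U, φ) satisfy: (i) there exists a linear function ρ(r) = C·r with C > 0 such that for all x₋, x, x₊ ∈ X with x₋ ≤ x ≤ x₊ one has ‖x‖_X ≤ ρ(‖x₋‖_X + ‖x₊‖_X); and (ii) there exists a linear function η(r) = C'·r with C' > 0 such that for every u ∈ U there exist u₋, u₊ ∈ U_c with u₋ ≤ u ≤ u₊, ‖u₋‖_U ≤ η(‖u‖_U) and ‖u₊‖_U ≤ η(‖u‖_U). If the system is exp-ISS with respect to inputs in U_c with a linear gain function, then it is exp-ISS with respect to all inputs in U with a linear gain function. -/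
open Filter Set

/-- exp-ISS with a linear gain function, with respect to inputs in `S`. -/
def ExpISSLinGainWrt {X U : Type*} [NormedAddCommGroup X] [NormedAddCommGroup U]
    (φ : ℝ → X → U → X) (S : Set U) : Prop :=
  ∃ M > (0:ℝ), ∃ a > (0:ℝ), ∃ g > (0:ℝ),
    ∀ x : X, ∀ u ∈ S, ∀ t ≥ (0:ℝ),
      ‖φ t x u‖ ≤ M * Real.exp (-a * t) * ‖x‖ + g * ‖u‖

/-- A system monotone w.r.t. inputs, with *linear* sandwich bound (i) on
states and *linear* bound (ii) on bounding inputs in `Uc`: if it is exp-ISS w.r.t. inputs in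
`Uc` with a linear gain, then it is exp-ISS w.r.t. all inputs with a linear gain. -/
theorem stmt2 {X U : Type*}
    [NormedAddCommGroup X] [NormedSpace ℝ X]
    [NormedAddCommGroup U] [NormedSpace ℝ U]
    (KX : Set X) (KU : Set U)
    (hKX : IsPositiveCone KX) (hKU : IsPositiveCone KU)
    (Uc : Set U)
    (φ : ℝ → X → U → X)
    (hmono : ∀ t ≥ (0:ℝ), ∀ (x : X) (u₁ u₂ : U),
      coneLE KU u₁ u₂ → coneLE KX (φ t x u₁) (φ t x u₂))
    (C : ℝ) (hC : 0 < C)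
    (hsandwich : ∀ xm x xp : X, coneLE KX xm x → coneLE KX x xp →
      ‖x‖ ≤ C * (‖xm‖ + ‖xp‖))
    (C' : ℝ) (hC' : 0 < C')
    (hinput : ∀ u : U, ∃ um ∈ Uc, ∃ up ∈ Uc,
      coneLE KU um u ∧ coneLE KU u up ∧ ‖um‖ ≤ C' * ‖u‖ ∧ ‖up‖ ≤ C' * ‖u‖)
    (hISS : ExpISSLinGainWrt φ Uc) :
    ExpISSLinGainWrt φ (univ : Set U) := by
  obtain ⟨M, hM, a, ha, g, hg, h⟩ := hISS
  refine ⟨2 * C * M, by positivity, a, ha, 2 * C * g * C', by positivity, ?_⟩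
  intro x u _ t ht
  obtain ⟨um, hum, up, hup, h1, h2, h3, h4⟩ := hinput u
  have hs := hsandwich _ _ _ (hmono t ht x um u h1) (hmono t ht x u up h2)
  have hm := h x um hum t ht
  have hp := h x up hup t ht
  have h5 := mul_le_mul_of_nonneg_left h3 hg.le
  have h6 := mul_le_mul_of_nonneg_left h4 hg.le
  calc ‖φ t x u‖ ≤ C * (‖φ t x um‖ + ‖φ t x up‖) := hs
    _ ≤ C * (2 * (M * Real.exp (-a * t) * ‖x‖) + 2 * (g * (C' * ‖u‖))) :=
        mul_le_mul_of_nonneg_left (by linarith) hC.le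
    _ = 2 * C * M * Real.exp (-a * t) * ‖x‖ + 2 * C * g * C' * ‖u‖ := by ring
end

section
/- Let the monotone-with-respect-to-states-and-inputs system (X, U, A, φ) satisfy: (i) there exists a linear function ρ(r) = C·r with C > 0 such that for all x₋, x, x₊ ∈ X with x₋ ≤ x ≤ x₊ one has ‖x‖_X ≤ ρ(‖x₋‖_X + ‖x₊‖_X); and (ii) there exist η of class K∞ and a linear function ξ(r) = C'·r with C' > 0 such that for every x ∈ X, every u ∈ A(x) and every ε > 0 there exist x₋, x₊ ∈ X, u₋ ∈ A(x₋) ∩ U_c and u₊ ∈ A(x₊) ∩ U_c with x₋ ≤ x ≤ x₊, u₋ ≤ u ≤ u₊, max(‖u₋‖_U, ‖u₊‖_U) ≤ η(‖u‖_U + ε) and max(‖x₋‖_X, ‖x₊‖_X) ≤ ξ(‖x‖_X + ‖u‖_U + ε). Then the system is exp-ISS (with respect to all admissible inputs) if and only if it is exp-ISS with respect to inputs in U_c. -/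
open Filter Set

/-- exp-ISS with respect to inputs in `S`, for a system with admissible input sets `A(x)`. -/
def ExpISSwrtAdm {X U : Type*} [NormedAddCommGroup X] [NormedAddCommGroup U]
    (φ : ℝ → X → U → X) (A : X → Set U) (S : Set U) : Prop :=
  ∃ M > (0:ℝ), ∃ a > (0:ℝ), ∃ γ : ℝ → ℝ, ClassKInf γ ∧
    ∀ x : X, ∀ u ∈ A x ∩ S, ∀ t ≥ (0:ℝ),
      ‖φ t x u‖ ≤ M * Real.exp (-a * t) * ‖x‖ + γ ‖u‖

/-- A system monotone w.r.t. states and inputs satisfying the *linear*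
sandwich property (i) and the approximation property (ii) with `ξ` linear is exp-ISS
(w.r.t. all admissible inputs) iff it is exp-ISS w.r.t. inputs in `Uc`. -/
theorem stmt4 {X U : Type*}
    [NormedAddCommGroup X] [NormedSpace ℝ X]
    [NormedAddCommGroup U] [NormedSpace ℝ U]
    (KX : Set X) (KU : Set U)
    (hKX : IsPositiveCone KX) (hKU : IsPositiveCone KU)
    (Uc : Set U) (A : X → Set U)
    (φ : ℝ → X → U → X)
    (hmono : ∀ t ≥ (0:ℝ), ∀ x₁ x₂ : X, coneLE KX x₁ x₂ →
      ∀ u₁ ∈ A x₁, ∀ u₂ ∈ A x₂, coneLE KU u₁ u₂ →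
        coneLE KX (φ t x₁ u₁) (φ t x₂ u₂))
    (C : ℝ) (hC : 0 < C)
    (hsandwich : ∀ xm x xp : X, coneLE KX xm x → coneLE KX x xp →
      ‖x‖ ≤ C * (‖xm‖ + ‖xp‖))
    (η : ℝ → ℝ) (hη : ClassKInf η)
    (C' : ℝ) (hC' : 0 < C')
    (happrox : ∀ x : X, ∀ u ∈ A x, ∀ ε > (0:ℝ),
      ∃ xm xp : X, ∃ um ∈ A xm ∩ Uc, ∃ up ∈ A xp ∩ Uc,
        coneLE KX xm x ∧ coneLE KX x xp ∧
        coneLE KU um u ∧ coneLE KU u up ∧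
        max ‖um‖ ‖up‖ ≤ η (‖u‖ + ε) ∧
        max ‖xm‖ ‖xp‖ ≤ C' * (‖x‖ + ‖u‖ + ε)) :
    ExpISSwrtAdm φ A (univ : Set U) ↔ ExpISSwrtAdm φ A Uc := by
  constructor
  · rintro ⟨M, hM, a, ha, γ, hγ, h⟩
    exact ⟨M, hM, a, ha, γ, hγ, fun x u hu t ht => h x u ⟨hu.1, mem_univ _⟩ t ht⟩
  · rintro ⟨M, hM, a, ha, γ, ⟨⟨γc, γm, γ0⟩, γt⟩, h⟩
    obtain ⟨⟨ηc, ηm, η0⟩, ηt⟩ := hη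
    have hηpos : ∀ r, 0 ≤ r → 0 ≤ η r := by
      intro r hr
      have := ηm.monotoneOn (mem_Ici.2 le_rfl) (mem_Ici.2 hr) hr
      rwa [η0] at this
    have hγpos : ∀ r, 0 ≤ r → 0 ≤ γ r := by
      intro r hr
      have := γm.monotoneOn (mem_Ici.2 le_rfl) (mem_Ici.2 hr) hr
      rwa [γ0] at this
    have hP : 0 < 2 * C * M * C' := by positivity
    have hcont : ContinuousOn (fun r => 2 * C * M * C' * r + 2 * C * γ (η r)) (Ici 0) := by
      apply ContinuousOn.add (by fun_prop)
      exact continuousOn_const.mul (γc.comp ηc (fun r hr => hηpos r hr))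
    refine ⟨2 * C * M * C', hP, a, ha,
      fun r => 2 * C * M * C' * r + 2 * C * γ (η r), ⟨⟨hcont, ?_, ?_⟩, ?_⟩, ?_⟩
    · intro r hr s hs hrs
      have h1 := γm (hηpos r hr) (hηpos s hs) (ηm hr hs hrs)
      have h2 := mul_lt_mul_of_pos_left hrs hP
      have h3 := mul_lt_mul_of_pos_left h1 (by positivity : 0 < 2 * C)
      exact add_lt_add h2 h3
    · simp [η0, γ0]
    · refine tendsto_atTop_mono' atTop ?_ (tendsto_id.const_mul_atTop hP)
      filter_upwards [eventually_ge_atTop 0] with r hr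
      have := mul_nonneg (by positivity : 0 ≤ 2 * C) (hγpos _ (hηpos r hr))
      simp only [id]
      linarith
    · intro x u hu t ht
      have key : ∀ ε > (0:ℝ), ‖φ t x u‖ ≤ 2 * C * M * C' * Real.exp (-a * t) * ‖x‖ +
          (2 * C * M * C' * (‖u‖ + ε) + 2 * C * γ (η (‖u‖ + ε))) := by
        intro ε hε
        obtain ⟨xm, xp, um, hum, up, hup, hx1, hx2, hu1, hu2, hun, hxn⟩ := happrox x u hu.1 ε hε
        have hs := hsandwich _ _ _ (hmono t ht xm x hx1 um hum.1 u hu.1 hu1)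
          (hmono t ht x xp hx2 u hu.1 up hup.1 hu2)
        have hm := h xm um hum t ht
        have hp := h xp up hup t ht
        have hr : 0 ≤ η (‖u‖ + ε) := hηpos _ (by positivity)
        have g1 := γm.monotoneOn (norm_nonneg um) hr ((le_max_left _ _).trans hun)
        have g2 := γm.monotoneOn (norm_nonneg up) hr ((le_max_right _ _).trans hun)
        have x1 := (le_max_left _ _).trans hxn
        have x2 := (le_max_right _ _).trans hxn
        have he0 : 0 < Real.exp (-a * t) := Real.exp_pos _
        have he1 : Real.exp (-a * t) ≤ 1 := by
          rw [Real.exp_le_one_iff]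
          nlinarith
        generalize Real.exp (-a * t) = e at *
        have hMe : 0 ≤ M * e := by positivity
        have y1 := mul_le_mul_of_nonneg_left x1 hMe
        have y2 := mul_le_mul_of_nonneg_left x2 hMe
        have hsum : ‖φ t xm um‖ + ‖φ t xp up‖ ≤
            2 * (M * e * (C' * (‖x‖ + ‖u‖ + ε))) + 2 * γ (η (‖u‖ + ε)) := by linarith
        have z := mul_le_mul_of_nonneg_left hsum hC.le
        have w : 2 * C * M * C' * (‖u‖ + ε) * e ≤ 2 * C * M * C' * (‖u‖ + ε) * 1 :=
          mul_le_mul_of_nonneg_left he1 (by positivity)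
        nlinarith
      have hlim : Tendsto (fun ε : ℝ => ‖u‖ + ε) (nhdsWithin 0 (Ioi 0))
          (nhdsWithin ‖u‖ (Ici 0)) := by
        apply tendsto_nhdsWithin_of_tendsto_nhds_of_eventually_within
        · have : Tendsto (fun ε : ℝ => ‖u‖ + ε) (nhds 0) (nhds (‖u‖ + 0)) :=
            (continuous_const.add continuous_id).tendsto 0
          rw [add_zero] at this
          exact this.mono_left nhdsWithin_le_nhds
        · filter_upwards [self_mem_nhdsWithin] with ε hε
          exact add_nonneg (norm_nonneg u) (le_of_lt hε)
      have hl2 := ((hcont ‖u‖ (norm_nonneg u)).tendsto.comp hlim).const_add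
        (2 * C * M * C' * Real.exp (-a * t) * ‖x‖)
      refine ge_of_tendsto hl2 ?_
      filter_upwards [self_mem_nhdsWithin] with ε hε
      exact key ε hε
end

section
/- Let the monotone-with-respect-to-states-and-inputs system (X, U, A, φ) satisfy: (i) there exists a linear function ρ(r) = C·r with C > 0 such that for all x₋, x, x₊ ∈ X with x₋ ≤ x ≤ x₊ one has ‖x‖_X ≤ ρ(‖x₋‖_X + ‖x₊‖_X); and (ii) there exist linear functions η(r) = C'·r and ξ(r) = C''·r with C', C'' > 0 such that for every x ∈ X, every u ∈ A(x) and every ε > 0 there exist x₋, x₊ ∈ X, u₋ ∈ A(x₋) ∩ U_c and u₊ ∈ A(x₊) ∩ U_c with x₋ ≤ x ≤ x₊, u₋ ≤ u ≤ u₊, max(‖u₋‖_U, ‖u₊‖_U) ≤ η(‖u‖_U + ε) and max(‖x₋‖_X, ‖x₊‖_X) ≤ ξ(‖x‖_X + ‖u‖_U + ε). If the system is exp-ISS with respect to inputs in U_c with a linear gain function, then it is exp-ISS (with respect to all admissible inputs) with a linear gain function. -/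
open Filter Set

/-- exp-ISS with a linear gain function, with respect to inputs in `S`, for a system with
admissible input sets `A(x)`. -/
def ExpISSLinGainWrtAdm {X U : Type*} [NormedAddCommGroup X] [NormedAddCommGroup U]
    (φ : ℝ → X → U → X) (A : X → Set U) (S : Set U) : Prop :=
  ∃ M > (0:ℝ), ∃ a > (0:ℝ), ∃ g > (0:ℝ),
    ∀ x : X, ∀ u ∈ A x ∩ S, ∀ t ≥ (0:ℝ),
      ‖φ t x u‖ ≤ M * Real.exp (-a * t) * ‖x‖ + g * ‖u‖

/-- A system monotone w.r.t. states and inputs satisfying the *linear*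
sandwich property (i) and the approximation property (ii) with `η` and `ξ` linear: if it is
exp-ISS w.r.t. inputs in `Uc` with a linear gain, then it is exp-ISS w.r.t. all admissible
inputs with a linear gain. -/
theorem stmt5 {X U : Type*}
    [NormedAddCommGroup X] [NormedSpace ℝ X]
    [NormedAddCommGroup U] [NormedSpace ℝ U]
    (KX : Set X) (KU : Set U)
    (hKX : IsPositiveCone KX) (hKU : IsPositiveCone KU)
    (Uc : Set U) (A : X → Set U)
    (φ : ℝ → X → U → X)
    (hmono : ∀ t ≥ (0:ℝ), ∀ x₁ x₂ : X, coneLE KX x₁ x₂ →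
      ∀ u₁ ∈ A x₁, ∀ u₂ ∈ A x₂, coneLE KU u₁ u₂ →
        coneLE KX (φ t x₁ u₁) (φ t x₂ u₂))
    (C : ℝ) (hC : 0 < C)
    (hsandwich : ∀ xm x xp : X, coneLE KX xm x → coneLE KX x xp →
      ‖x‖ ≤ C * (‖xm‖ + ‖xp‖))
    (C' : ℝ) (hC' : 0 < C') (C'' : ℝ) (hC'' : 0 < C'')
    (happrox : ∀ x : X, ∀ u ∈ A x, ∀ ε > (0:ℝ),
      ∃ xm xp : X, ∃ um ∈ A xm ∩ Uc, ∃ up ∈ A xp ∩ Uc,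
        coneLE KX xm x ∧ coneLE KX x xp ∧
        coneLE KU um u ∧ coneLE KU u up ∧
        max ‖um‖ ‖up‖ ≤ C' * (‖u‖ + ε) ∧
        max ‖xm‖ ‖xp‖ ≤ C'' * (‖x‖ + ‖u‖ + ε))
    (hISS : ExpISSLinGainWrtAdm φ A Uc) :
    ExpISSLinGainWrtAdm φ A (univ : Set U) := by
  obtain ⟨M, hM, a, ha, g, hg, H⟩ := hISS
  have hG : 0 < 2 * C * (M * C'' + g * C') := by positivity
  refine ⟨2 * C * (M * C''), by positivity, a, ha, 2 * C * (M * C'' + g * C'), hG, ?_⟩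
  intro x u hu t ht
  apply le_of_forall_pos_le_add
  intro δ hδ
  obtain ⟨ε, hε, hεδ⟩ : ∃ ε > (0:ℝ), 2 * C * (M * C'' + g * C') * ε = δ :=
    ⟨δ / (2 * C * (M * C'' + g * C')), div_pos hδ hG, mul_div_cancel₀ δ hG.ne'⟩
  obtain ⟨xm, xp, um, hum, up, hup, h1, h2, h3, h4, h5, h6⟩ := happrox x u hu.1 ε hε
  have hs := hsandwich _ _ _ (hmono t ht xm x h1 um hum.1 u hu.1 h3)
    (hmono t ht x xp h2 u hu.1 up hup.1 h4)
  have hE0 : 0 < Real.exp (-a * t) := Real.exp_pos _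
  have hE1 : Real.exp (-a * t) ≤ 1 := Real.exp_le_one_iff.2 (by nlinarith)
  have Hm := H xm um hum t ht
  have Hp := H xp up hup t ht
  generalize Real.exp (-a * t) = E at *
  have key : ∀ y : X, ∀ v : U, ‖v‖ ≤ C' * (‖u‖ + ε) → ‖y‖ ≤ C'' * (‖x‖ + ‖u‖ + ε) →
      M * E * ‖y‖ + g * ‖v‖ ≤ M * C'' * E * ‖x‖ + (M * C'' + g * C') * (‖u‖ + ε) := by
    intro y v hv hy
    have hP : 0 ≤ M * C'' * (‖u‖ + ε) := by positivity
    calc M * E * ‖y‖ + g * ‖v‖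
        ≤ M * E * (C'' * (‖x‖ + ‖u‖ + ε)) + g * (C' * (‖u‖ + ε)) := by gcongr
      _ = M * C'' * E * ‖x‖ + E * (M * C'' * (‖u‖ + ε)) + g * C' * (‖u‖ + ε) := by ring
      _ ≤ M * C'' * E * ‖x‖ + 1 * (M * C'' * (‖u‖ + ε)) + g * C' * (‖u‖ + ε) := by gcongr
      _ = _ := by ring
  have km := Hm.trans (key xm um ((le_max_left _ _).trans h5) ((le_max_left _ _).trans h6))
  have kp := Hp.trans (key xp up ((le_max_right _ _).trans h5) ((le_max_right _ _).trans h6))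
  calc _ ≤ _ := hs
    _ ≤ C * ((M * C'' * E * ‖x‖ + (M * C'' + g * C') * (‖u‖ + ε)) +
        (M * C'' * E * ‖x‖ + (M * C'' + g * C') * (‖u‖ + ε))) := by gcongr
    _ = _ := by rw [← hεδ]; ring
end

section
/- Comparison principle: let L be uniformly parabolic and assume that for every bounded set W ⊂ ℝ there is a constant k > 0 such that for every w₁, w₂ ∈ W with w₁ > w₂, every z ∈ G and every ξ ∈ ℝⁿ one has f(z, w₁, ξ) − f(z, w₂, ξ) < k(w₁ − w₂). Let x, y ∈ C⁰(closure(D)) ∩ C^{1,2}(D) satisfy (Ly)(t,z) ≥ 0 ≥ (Lx)(t,z) for all (t,z) ∈ D, y(0,z) ≥ x(0,z) for all z ∈ G, and y(t,z) ≥ x(t,z) for all (t,z) ∈ [0,T] × ∂G. Then y(t,z) ≥ x(t,z) for all (t,z) ∈ closure(D). -/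
open MeasureTheory Set Filter

noncomputable section

/-- The `i`-th coordinate direction in `ℝⁿ`. -/
def edir (n : ℕ) (i : Fin n) : EuclideanSpace ℝ (Fin n) := EuclideanSpace.single i (1:ℝ)

/-- Second partial derivative `∂²u/(∂z_i ∂z_j)` at `z`. -/
def pder2 {n : ℕ} (u : EuclideanSpace ℝ (Fin n) → ℝ) (z : EuclideanSpace ℝ (Fin n))
    (i j : Fin n) : ℝ :=
  fderiv ℝ (fun w => fderiv ℝ u w (edir n i)) z (edir n j)

/-- Gradient `∇u(z)`, viewed as a vector of `ℝⁿ`. -/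
def grad {n : ℕ} (u : EuclideanSpace ℝ (Fin n) → ℝ) (z : EuclideanSpace ℝ (Fin n)) :
    EuclideanSpace ℝ (Fin n) :=
  (WithLp.equiv 2 (Fin n → ℝ)).symm fun i => fderiv ℝ u z (edir n i)

/-- The parabolic operator
`(Lx)(t,z) = ∂x/∂t(t,z) − Σ_{i,j} a_{ij}(z) ∂²x/(∂z_i∂z_j)(t,z) − f(z, x(t,z), ∇_z x(t,z))`. -/
def Lop {n : ℕ} (a : Fin n → Fin n → EuclideanSpace ℝ (Fin n) → ℝ)
    (f : EuclideanSpace ℝ (Fin n) → ℝ → EuclideanSpace ℝ (Fin n) → ℝ)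
    (x : ℝ → EuclideanSpace ℝ (Fin n) → ℝ) (t : ℝ) (z : EuclideanSpace ℝ (Fin n)) : ℝ :=
  deriv (fun s => x s z) t
    - ∑ i, ∑ j, a i j z * pder2 (x t) z i j
    - f z (x t z) (grad (x t) z)

/-- `x ∈ C^{1,2}(D)`: once continuously differentiable in `t` and twice continuously
differentiable in `z` on `D`. -/
def C12On {n : ℕ} (x : ℝ → EuclideanSpace ℝ (Fin n) → ℝ)
    (D : Set (ℝ × EuclideanSpace ℝ (Fin n))) : Prop :=
  (∀ p ∈ D, DifferentiableAt ℝ (fun s => x s p.2) p.1) ∧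
  ContinuousOn (fun p : ℝ × EuclideanSpace ℝ (Fin n) => deriv (fun s => x s p.2) p.1) D ∧
  (∀ p ∈ D, DifferentiableAt ℝ (x p.1) p.2) ∧
  (∀ p ∈ D, DifferentiableAt ℝ (fun w => fderiv ℝ (x p.1) w) p.2) ∧
  ContinuousOn
    (fun p : ℝ × EuclideanSpace ℝ (Fin n) => fderiv ℝ (fun w => fderiv ℝ (x p.1) w) p.2) D

/-- `L` is uniformly parabolic: `Σ_{i,j} a_{ij}(z) ξ_i ξ_j ≥ K|ξ|²` on `closure G`. -/
def UniformlyParabolic {n : ℕ} (G : Set (EuclideanSpace ℝ (Fin n)))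
    (a : Fin n → Fin n → EuclideanSpace ℝ (Fin n) → ℝ) : Prop :=
  ∃ K > (0:ℝ), ∀ z ∈ closure G, ∀ ξ : EuclideanSpace ℝ (Fin n),
    K * ‖ξ‖ ^ 2 ≤ ∑ i, ∑ j, a i j z * ξ i * ξ j

/-- For every bounded `W ⊂ ℝ` there is `k > 0` with
`f(z,w₁,ξ) − f(z,w₂,ξ) < k(w₁ − w₂)` for all `w₁ > w₂` in `W`, `z ∈ G`, `ξ ∈ ℝⁿ`. -/
def OneSidedLip {n : ℕ} (G : Set (EuclideanSpace ℝ (Fin n)))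
    (f : EuclideanSpace ℝ (Fin n) → ℝ → EuclideanSpace ℝ (Fin n) → ℝ) : Prop :=
  ∀ W : Set ℝ, Bornology.IsBounded W → ∃ k > (0:ℝ),
    ∀ w₁ ∈ W, ∀ w₂ ∈ W, w₂ < w₁ → ∀ z ∈ G, ∀ ξ : EuclideanSpace ℝ (Fin n),
      f z w₁ ξ - f z w₂ ξ < k * (w₁ - w₂)

open Topology in
lemma aux_second_deriv {n : ℕ} (u : EuclideanSpace ℝ (Fin n) → ℝ) (z : EuclideanSpace ℝ (Fin n))
    (h1 : ∀ᶠ w in 𝓝 z, DifferentiableAt ℝ u w)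
    (h2 : DifferentiableAt ℝ (fun w => fderiv ℝ u w) z)
    (hmax : IsLocalMax u z) (v : EuclideanSpace ℝ (Fin n)) :
    fderiv ℝ (fun w => fderiv ℝ u w) z v v ≤ 0 := by
  by_contra hcon
  push Not at hcon
  set l : ℝ → EuclideanSpace ℝ (Fin n) := fun s => z + s • v with hl
  have hl0 : l 0 = z := by simp [hl]
  have hld : ∀ s, HasDerivAt l v s := by
    intro s
    have := ((hasDerivAt_id s).smul_const v).const_add z
    simpa [hl] using this
  have hlc : Tendsto l (𝓝 0) (𝓝 z) := by
    have := (hld 0).continuousAt.tendsto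
    rwa [hl0] at this
  set g : ℝ → ℝ := fun s => u (l s) with hg
  have hgmax : IsLocalMax g 0 := by
    have := hlc.eventually hmax
    filter_upwards [this] with s hs
    simpa [hg, hl0] using hs
  have hgd : ∀ᶠ s in 𝓝 (0:ℝ), deriv g s = fderiv ℝ u (l s) v := by
    filter_upwards [hlc.eventually h1] with s hs
    exact (hs.hasFDerivAt.comp_hasDerivAt s (hld s)).deriv
  have hg2 : deriv (deriv g) 0 = fderiv ℝ (fun w => fderiv ℝ u w) z v v := by
    rw [EventuallyEq.deriv_eq hgd]
    have h2' : HasFDerivAt (fun w => fderiv ℝ u w) (fderiv ℝ (fun w => fderiv ℝ u w) z) (l 0) := by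
      rw [hl0]; exact h2.hasFDerivAt
    have := (h2'.comp_hasDerivAt (0:ℝ) (hld 0)).clm_apply (hasDerivAt_const (0:ℝ) v)
    simpa using this.deriv
  have hgc : ContinuousAt g 0 := by
    have h := h1.self_of_nhds
    rw [← hl0] at h
    exact (h.hasFDerivAt.comp_hasDerivAt 0 (hld 0)).continuousAt
  have hmin := isLocalMin_of_deriv_deriv_pos (by rw [hg2]; exact hcon) hgmax.deriv_eq_zero hgc
  have hconst : g =ᶠ[𝓝 0] fun _ => g 0 := by
    filter_upwards [hgmax, hmin] with s a b
    exact le_antisymm a b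
  have : deriv (deriv g) 0 = 0 := by
    rw [hconst.deriv.deriv_eq]; simp
  linarith [hg2]

open scoped MatrixOrder Matrix.Norms.L2Operator in
lemma aux_trace {n : ℕ} (A H : Matrix (Fin n) (Fin n) ℝ)
    (hA : ∀ ξ : Fin n → ℝ, 0 ≤ ∑ i, ∑ j, A i j * ξ i * ξ j)
    (hs : ∀ i j, H i j = H j i)
    (hH : ∀ ξ : Fin n → ℝ, ∑ i, ∑ j, H i j * ξ i * ξ j ≤ 0) :
    ∑ i, ∑ j, A i j * H i j ≤ 0 := by
  have hp : (-H).PosSemidef := by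
    refine Matrix.PosSemidef.of_dotProduct_mulVec_nonneg ?_ ?_
    · ext i j; simp [hs i j]
    · intro ξ
      have := hH ξ
      have e : star ξ ⬝ᵥ ((-H).mulVec ξ) = -∑ i, ∑ j, H i j * ξ i * ξ j := by
        simp only [dotProduct, Matrix.mulVec, Finset.mul_sum, ← Finset.sum_neg_distrib]
        refine Finset.sum_congr rfl fun i _ => Finset.sum_congr rfl fun j _ => ?_
        simp; ring
      rw [e]; linarith
  obtain ⟨B, hB⟩ := CStarAlgebra.nonneg_iff_eq_star_mul_self.mp hp.nonneg
  have e : ∀ i j, H i j = -∑ k, B k i * B k j := by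
    intro i j
    have := congrFun (congrFun hB i) j
    simp [Matrix.mul_apply] at this
    linarith
  have : ∑ i, ∑ j, A i j * H i j = -∑ k, ∑ i, ∑ j, A i j * B k i * B k j := by
    rw [Finset.sum_comm (s := Finset.univ) (t := Finset.univ)
      (f := fun k i => ∑ j, A i j * B k i * B k j), ← Finset.sum_neg_distrib]
    refine Finset.sum_congr rfl fun i _ => ?_
    rw [Finset.sum_comm, ← Finset.sum_neg_distrib]
    refine Finset.sum_congr rfl fun j _ => ?_
    rw [e, mul_neg, Finset.mul_sum]
    congr 1
    refine Finset.sum_congr rfl fun k _ => ?_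
    ring
  rw [this]
  have := Finset.sum_nonneg (s := Finset.univ) fun k _ => hA (B k)
  linarith

open Topology in
lemma aux_pder2 {n : ℕ} (u : EuclideanSpace ℝ (Fin n) → ℝ) (z : EuclideanSpace ℝ (Fin n))
    (h2 : DifferentiableAt ℝ (fun w => fderiv ℝ u w) z) (i j : Fin n) :
    pder2 u z i j = fderiv ℝ (fun w => fderiv ℝ u w) z (edir n j) (edir n i) := by
  unfold pder2
  have := (h2.hasFDerivAt.clm_apply (hasFDerivAt_const (edir n i) z)).fderiv
  rw [this]; simp

open Topology in
lemma aux_elliptic {n : ℕ} (u : EuclideanSpace ℝ (Fin n) → ℝ) (z : EuclideanSpace ℝ (Fin n))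
    (A : Matrix (Fin n) (Fin n) ℝ)
    (hA : ∀ ξ : Fin n → ℝ, 0 ≤ ∑ i, ∑ j, A i j * ξ i * ξ j)
    (h1 : ∀ᶠ w in 𝓝 z, DifferentiableAt ℝ u w)
    (h2 : DifferentiableAt ℝ (fun w => fderiv ℝ u w) z)
    (hmax : IsLocalMax u z) :
    ∑ i, ∑ j, A i j * pder2 u z i j ≤ 0 := by
  refine aux_trace A (fun i j => pder2 u z i j) hA ?_ ?_
  · intro i j
    simp only [aux_pder2 u z h2]
    exact second_derivative_symmetric_of_eventually
      (h1.mono fun w hw => hw.hasFDerivAt) h2.hasFDerivAt _ _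
  · intro ξ
    have := aux_second_deriv u z h1 h2 hmax (∑ i, ξ i • edir n i)
    refine le_of_eq_of_le ?_ this
    simp only [aux_pder2 u z h2, map_sum, map_smul, ContinuousLinearMap.sum_apply,
      ContinuousLinearMap.smul_apply, smul_eq_mul, Finset.mul_sum]
    refine Finset.sum_congr rfl fun i _ => Finset.sum_congr rfl fun j _ => ?_
    ring

open Topology in
lemma aux_time (h : ℝ → ℝ) (h' t : ℝ) (ht : 0 < t) (hd : HasDerivAt h h' t)
    (hm : ∀ s ∈ Icc 0 t, h s ≤ h t) : 0 ≤ h' := by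
  have := (hasDerivWithinAt_iff_tendsto_slope' (s := Iio t) (by simp)).mp hd.hasDerivWithinAt
  refine ge_of_tendsto this ?_
  filter_upwards [Ioo_mem_nhdsLT ht] with s hs
  rw [slope_def_field]
  exact div_nonneg_of_nonpos (by linarith [hm s ⟨hs.1.le, hs.2.le⟩]) (by linarith [hs.2])

/-- **comparison principle.** Let `L` be uniformly parabolic with one-sided
Lipschitz nonlinearity, `D = (0,T) × G`. If `x, y ∈ C⁰(closure D) ∩ C^{1,2}(D)` satisfy
`Ly ≥ 0 ≥ Lx` on `D`, `y(0,·) ≥ x(0,·)` on `G`, and `y ≥ x` on `[0,T] × ∂G`, then `y ≥ x`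
on `closure D`. -/
theorem stmt6 {n : ℕ} (G : Set (EuclideanSpace ℝ (Fin n)))
    (hGne : G.Nonempty) (hGopen : IsOpen G) (hGbdd : Bornology.IsBounded G)
    (T : ℝ) (hT : 0 < T)
    (a : Fin n → Fin n → EuclideanSpace ℝ (Fin n) → ℝ)
    (ha : ∀ i j, ContinuousOn (a i j) (closure G))
    (f : EuclideanSpace ℝ (Fin n) → ℝ → EuclideanSpace ℝ (Fin n) → ℝ)
    (hf : ContinuousOn
      (fun q : EuclideanSpace ℝ (Fin n) × ℝ × EuclideanSpace ℝ (Fin n) => f q.1 q.2.1 q.2.2)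
      (G ×ˢ (univ : Set ℝ) ×ˢ (univ : Set (EuclideanSpace ℝ (Fin n)))))
    (hpar : UniformlyParabolic G a)
    (hlip : OneSidedLip G f)
    (x y : ℝ → EuclideanSpace ℝ (Fin n) → ℝ)
    (hxC : ContinuousOn (fun p : ℝ × EuclideanSpace ℝ (Fin n) => x p.1 p.2)
      (closure (Ioo 0 T ×ˢ G)))
    (hyC : ContinuousOn (fun p : ℝ × EuclideanSpace ℝ (Fin n) => y p.1 p.2)
      (closure (Ioo 0 T ×ˢ G)))
    (hx12 : C12On x (Ioo 0 T ×ˢ G)) (hy12 : C12On y (Ioo 0 T ×ˢ G))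
    (hL : ∀ p ∈ Ioo 0 T ×ˢ G, Lop a f x p.1 p.2 ≤ 0 ∧ 0 ≤ Lop a f y p.1 p.2)
    (hinit : ∀ z ∈ G, x 0 z ≤ y 0 z)
    (hbdry : ∀ t ∈ Icc 0 T, ∀ z ∈ frontier G, x t z ≤ y t z) :
    ∀ p ∈ closure (Ioo 0 T ×ˢ G), x p.1 p.2 ≤ y p.1 p.2 := by
  intro p hp
  refine le_on_closure (f := fun p : ℝ × EuclideanSpace ℝ (Fin n) => x p.1 p.2)
    (g := fun p : ℝ × EuclideanSpace ℝ (Fin n) => y p.1 p.2) ?_ hxC hyC hp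
  clear hp p
  rintro ⟨t₁, z₁⟩ ⟨ht₁, hz₁⟩
  simp only at ht₁ hz₁ ⊢
  by_contra hcon
  push Not at hcon
  have hcl : closure (Ioo 0 T ×ˢ G) = Icc 0 T ×ˢ closure G := by
    rw [closure_prod_eq, closure_Ioo hT.ne]
  rw [hcl] at hxC hyC
  have hcG : IsCompact (closure G) := hGbdd.isCompact_closure
  have hcD : IsCompact (Icc 0 T ×ˢ closure G) := isCompact_Icc.prod hcG
  obtain ⟨k, hk, hkl⟩ := hlip
    ((fun p : ℝ × EuclideanSpace ℝ (Fin n) => x p.1 p.2) '' (Icc 0 T ×ˢ closure G) ∪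
     (fun p : ℝ × EuclideanSpace ℝ (Fin n) => y p.1 p.2) '' (Icc 0 T ×ˢ closure G))
    ((hcD.image_of_continuousOn hxC).isBounded.union (hcD.image_of_continuousOn hyC).isBounded)
  have hsub : Icc 0 t₁ ×ˢ closure G ⊆ Icc 0 T ×ˢ closure G :=
    prod_mono (Icc_subset_Icc le_rfl ht₁.2.le) le_rfl
  have hmem1 : (t₁, z₁) ∈ Icc 0 t₁ ×ˢ closure G := ⟨⟨ht₁.1.le, le_rfl⟩, subset_closure hz₁⟩
  obtain ⟨⟨t, z⟩, ⟨ht, hz⟩, hmax⟩ := (isCompact_Icc.prod hcG).exists_isMaxOn ⟨_, hmem1⟩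
    (f := fun p : ℝ × EuclideanSpace ℝ (Fin n) => Real.exp (-k * p.1) * (x p.1 p.2 - y p.1 p.2))
    (ContinuousOn.mul (by fun_prop) ((hxC.mono hsub).sub (hyC.mono hsub)))
  simp only at ht hz
  rw [isMaxOn_iff] at hmax
  have hpos : 0 < x t z - y t z := by
    have h := hmax _ hmem1
    simp only at h
    have h1 : 0 < Real.exp (-k * t₁) * (x t₁ z₁ - y t₁ z₁) :=
      mul_pos (Real.exp_pos _) (by linarith)
    exact (mul_pos_iff_of_pos_left (Real.exp_pos _)).mp (h1.trans_le h)
  have htT : t < T := ht.2.trans_lt ht₁.2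
  have hzG : z ∈ G := by
    by_contra hzn
    have : z ∈ frontier G := by
      rw [hGopen.frontier_eq]; exact ⟨hz, hzn⟩
    linarith [hbdry t ⟨ht.1, htT.le⟩ z this]
  have ht0 : 0 < t := by
    rcases ht.1.eq_or_lt with h | h
    · subst h
      linarith [hinit z hzG]
    · exact h
  have hD : (t, z) ∈ Ioo 0 T ×ˢ G := ⟨⟨ht0, htT⟩, hzG⟩
  have hDw : ∀ w ∈ G, (t, w) ∈ Ioo 0 T ×ˢ G := fun w hw => ⟨⟨ht0, htT⟩, hw⟩
  have hGn := hGopen.mem_nhds hzG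
  obtain ⟨hx1, -, hx2, hx3, -⟩ := hx12
  obtain ⟨hy1, -, hy2, hy3, -⟩ := hy12
  -- time derivative
  have htime : k * (x t z - y t z) ≤ deriv (fun s => x s z) t - deriv (fun s => y s z) t := by
    have hd1 := (hx1 _ hD).hasDerivAt.sub (hy1 _ hD).hasDerivAt
    have hd2 : HasDerivAt (fun s => Real.exp (-k * s)) (Real.exp (-k * t) * (-k)) t := by
      simpa using ((hasDerivAt_id t).const_mul (-k)).exp
    have := aux_time _ _ t ht0 (hd2.mul hd1) (by
      intro s hs
      exact hmax (s, z) ⟨⟨hs.1, hs.2.trans ht.2⟩, hz⟩)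
    simp only [Pi.sub_apply] at this
    have h3 : 0 ≤ Real.exp (-k * t) * ((deriv (fun s => x s z) t - deriv (fun s => y s z) t)
        - k * (x t z - y t z)) := by
      refine this.trans_eq ?_
      ring
    have := nonneg_of_mul_nonneg_right h3 (Real.exp_pos _)
    linarith
  -- space maximum
  set u : EuclideanSpace ℝ (Fin n) → ℝ := fun w => x t w - y t w with hu
  have humax : IsLocalMax u z := by
    filter_upwards [hGn] with w hw
    have := hmax (t, w) ⟨ht, subset_closure hw⟩
    exact le_of_mul_le_mul_left this (Real.exp_pos _)
  have hu1 : ∀ w ∈ G, HasFDerivAt u (fderiv ℝ (x t) w - fderiv ℝ (y t) w) w := fun w hw =>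
    (hx2 _ (hDw w hw)).hasFDerivAt.sub (hy2 _ (hDw w hw)).hasFDerivAt
  have hfu : (fun w => fderiv ℝ u w) =ᶠ[nhds z] fun w => fderiv ℝ (x t) w - fderiv ℝ (y t) w := by
    filter_upwards [hGn] with w hw
    exact (hu1 w hw).fderiv
  have hdd := (hx3 _ hD).hasFDerivAt.sub (hy3 _ hD).hasFDerivAt
  have hu2 := hdd.congr_of_eventuallyEq hfu
  obtain ⟨K, hK, hKa⟩ := hpar
  have hell := aux_elliptic u z (fun i j => a i j z) (by
    intro ξ
    have := hKa z hz (WithLp.toLp 2 ξ)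
    refine le_trans (by positivity) this)
    (by filter_upwards [hGn] with w hw using (hu1 w hw).differentiableAt)
    hu2.differentiableAt humax
  have hp2 : ∀ i j, pder2 u z i j = pder2 (x t) z i j - pder2 (y t) z i j := by
    intro i j
    rw [aux_pder2 _ _ hu2.differentiableAt, aux_pder2 _ _ (hx3 _ hD), aux_pder2 _ _ (hy3 _ hD),
      hu2.fderiv]
    simp
  simp only [hp2, mul_sub, Finset.sum_sub_distrib] at hell
  have hgr : fderiv ℝ (x t) z = fderiv ℝ (y t) z := by
    have := humax.fderiv_eq_zero
    rw [(hu1 z hzG).fderiv] at this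
    exact sub_eq_zero.mp this
  have hgrad : grad (x t) z = grad (y t) z := by
    unfold grad; rw [hgr]
  obtain ⟨hLx, hLy⟩ := hL _ hD
  unfold Lop at hLx hLy
  simp only [hgrad] at hLx hLy
  have hmT : (t, z) ∈ Icc 0 T ×ˢ closure G := ⟨⟨ht.1, htT.le⟩, hz⟩
  have := hkl (x t z) (Or.inl ⟨(t, z), hmT, rfl⟩) (y t z) (Or.inr ⟨(t, z), hmT, rfl⟩)
    (by linarith) z hzG (grad (y t) z)
  linarith

end
end

section
/- Monotonicity of the parabolic boundary-value problem: let L be uniformly parabolic on (0,∞) × G and assume that for every bounded set W ⊂ ℝ there is a constant k > 0 such that for every w₁, w₂ ∈ W with w₁ > w₂, every z ∈ G and every ξ ∈ ℝⁿ one has f(z, w₁, ξ) − f(z, w₂, ξ) < k(w₁ − w₂). If x, y ∈ C⁰(ℝ≥0 × closure(G)) ∩ C^{1,2}((0,∞) × G) satisfy (Lx)(t,z) = (Ly)(t,z) = 0 for all (t,z) ∈ (0,∞) × G, x(0,z) ≤ y(0,z) for all z ∈ G, and x(t,z) ≤ y(t,z) for all (t,z) ∈ ℝ≥0 × ∂G,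 then x(t,z) ≤ y(t,z) for all (t,z) ∈ ℝ≥0 × closure(G). -/
open MeasureTheory Set Filter

noncomputable section

lemma hess_nonpos {E : Type*} [NormedAddCommGroup E] [NormedSpace ℝ E] (g : E → ℝ) (z : E)
    (hg : ∀ᶠ w in nhds z, DifferentiableAt ℝ g w)
    (h2 : DifferentiableAt ℝ (fderiv ℝ g) z) (hmax : IsLocalMax g z) (v : E) :
    fderiv ℝ (fderiv ℝ g) z v v ≤ 0 := by
  by_contra! hpos
  let l : ℝ → E := fun s => z + s • v
  have hl0 : l 0 = z := by simp [l]
  have hl : ∀ s, HasDerivAt l v s := fun s => by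
    simpa [l] using ((hasDerivAt_id s).smul_const v).const_add z
  have hlc : Tendsto l (nhds 0) (nhds z) := by
    have := (hl 0).continuousAt.tendsto
    rwa [hl0] at this
  have hd : ∀ᶠ s in nhds (0:ℝ), HasDerivAt (fun s => g (l s)) (fderiv ℝ g (l s) v) s := by
    filter_upwards [hlc.eventually hg] with s hs
    exact hs.hasFDerivAt.comp_hasDerivAt s (hl s)
  have hde : deriv (fun s => g (l s)) =ᶠ[nhds 0] fun s => fderiv ℝ g (l s) v := by
    filter_upwards [hd] with s hs using hs.deriv
  have hdd : HasDerivAt (fun s => fderiv ℝ g (l s) v) (fderiv ℝ (fderiv ℝ g) z v v) 0 := by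
    have h2' : HasFDerivAt (fderiv ℝ g) (fderiv ℝ (fderiv ℝ g) z) (l 0) := by
      rw [hl0]; exact h2.hasFDerivAt
    have := (h2'.comp_hasDerivAt (0:ℝ) (hl 0)).clm_apply (hasDerivAt_const (0:ℝ) v)
    simpa using this
  have hdd' : deriv (deriv (fun s => g (l s))) 0 = fderiv ℝ (fderiv ℝ g) z v v := by
    rw [hde.deriv_eq, hdd.deriv]
  have hmaxl : IsLocalMax (fun s => g (l s)) 0 := by
    have := hlc.eventually hmax
    simpa [IsLocalMax, IsMaxFilter, hl0] using this
  have hmin : IsLocalMin (fun s => g (l s)) 0 := by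
    apply isLocalMin_of_deriv_deriv_pos
    · rw [hdd']; exact hpos
    · exact hmaxl.deriv_eq_zero
    · exact hd.self_of_nhds.continuousAt
  have hconst : (fun s => g (l s)) =ᶠ[nhds 0] fun _ => g (l 0) := by
    filter_upwards [hmaxl, hmin] with s h1 h2 using le_antisymm h1 h2
  have : deriv (deriv (fun s => g (l s))) 0 = 0 := by
    rw [hconst.deriv.deriv_eq]; simp
  linarith

open scoped MatrixOrder in
lemma trace_nonpos {n : ℕ} (A H : Fin n → Fin n → ℝ)
    (hA : ∀ ξ : Fin n → ℝ, 0 ≤ ∑ i, ∑ j, A i j * ξ i * ξ j)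
    (hs : ∀ i j, H i j = H j i)
    (hH : ∀ ξ : Fin n → ℝ, ∑ i, ∑ j, H i j * ξ i * ξ j ≤ 0) :
    ∑ i, ∑ j, A i j * H i j ≤ 0 := by
  let M : Matrix (Fin n) (Fin n) ℝ := Matrix.of fun i j => - H i j
  have hM : M.PosSemidef := by
    apply Matrix.PosSemidef.of_dotProduct_mulVec_nonneg
    · ext i j; simp [M, hs i j]
    · intro ξ
      have := hH ξ
      have e : star ξ ⬝ᵥ M.mulVec ξ = - ∑ i, ∑ j, H i j * ξ i * ξ j := by
        simp only [dotProduct, Matrix.mulVec, M, Matrix.of_apply, Finset.mul_sum,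
          ← Finset.sum_neg_distrib]
        refine Finset.sum_congr rfl fun i _ => Finset.sum_congr rfl fun j _ => ?_
        simp; ring
      rw [e]; linarith
  obtain ⟨B, hB⟩ := CStarAlgebra.nonneg_iff_eq_star_mul_self.mp hM.nonneg
  have hBe : ∀ i j, H i j = - ∑ k, B k i * B k j := by
    intro i j
    have := congrFun (congrFun hB i) j
    simp only [M, Matrix.of_apply, Matrix.mul_apply, Matrix.star_apply, star_trivial] at this
    linarith
  have : ∑ i, ∑ j, A i j * H i j = - ∑ k, ∑ i, ∑ j, A i j * B k i * B k j := by
    rw [Finset.sum_comm, ← Finset.sum_neg_distrib]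
    simp only [hBe, mul_neg, Finset.mul_sum, Finset.sum_neg_distrib]
    rw [Finset.sum_comm]
    congr 1
    rw [Finset.sum_comm (γ := Fin n) (s := Finset.univ (α := Fin n))]
    simp only [← mul_assoc]
    conv_rhs => rw [Finset.sum_comm]
    rw [Finset.sum_comm]
    refine Finset.sum_congr rfl fun i _ => ?_
    rw [Finset.sum_comm]
  rw [this]
  have := Finset.sum_nonneg fun k (_ : k ∈ Finset.univ) => hA (B k)
  linarith

lemma left_deriv_nonneg {φ : ℝ → ℝ} {d t : ℝ} (h : HasDerivAt φ d t) (ht : 0 < t)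
    (hm : ∀ s, 0 ≤ s → s ≤ t → φ s ≤ φ t) : 0 ≤ d := by
  have h1 : HasDerivWithinAt φ d (Iio t) t := h.hasDerivWithinAt
  rw [hasDerivWithinAt_iff_tendsto_slope' (by simp)] at h1
  refine ge_of_tendsto h1 ?_
  have : Ioo 0 t ∈ nhdsWithin t (Iio t) := Ioo_mem_nhdsLT ht
  filter_upwards [this] with s hs
  rw [slope_def_field]
  exact div_nonneg_of_nonpos (by linarith [hm s hs.1.le hs.2.le]) (by linarith [hs.2])

/-- **monotonicity of the parabolic boundary-value problem.** Let `L` be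
uniformly parabolic on `(0,∞) × G` with one-sided Lipschitz nonlinearity. If
`x, y ∈ C⁰(ℝ≥0 × closure G) ∩ C^{1,2}((0,∞) × G)` satisfy `Lx = Ly = 0` on `(0,∞) × G`,
`x(0,·) ≤ y(0,·)` on `G` and `x ≤ y` on `ℝ≥0 × ∂G`, then `x ≤ y` on `ℝ≥0 × closure G`. -/
theorem stmt8 {n : ℕ} (G : Set (EuclideanSpace ℝ (Fin n)))
    (hGne : G.Nonempty) (hGopen : IsOpen G) (hGbdd : Bornology.IsBounded G)
    (a : Fin n → Fin n → EuclideanSpace ℝ (Fin n) → ℝ)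
    (ha : ∀ i j, ContinuousOn (a i j) (closure G))
    (f : EuclideanSpace ℝ (Fin n) → ℝ → EuclideanSpace ℝ (Fin n) → ℝ)
    (hf : ContinuousOn
      (fun q : EuclideanSpace ℝ (Fin n) × ℝ × EuclideanSpace ℝ (Fin n) => f q.1 q.2.1 q.2.2)
      (G ×ˢ (univ : Set ℝ) ×ˢ (univ : Set (EuclideanSpace ℝ (Fin n)))))
    (hpar : UniformlyParabolic G a)
    (hlip : OneSidedLip G f)
    (x y : ℝ → EuclideanSpace ℝ (Fin n) → ℝ)
    (hxC : ContinuousOn (fun p : ℝ × EuclideanSpace ℝ (Fin n) => x p.1 p.2)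
      (Ici 0 ×ˢ closure G))
    (hyC : ContinuousOn (fun p : ℝ × EuclideanSpace ℝ (Fin n) => y p.1 p.2)
      (Ici 0 ×ˢ closure G))
    (hx12 : C12On x (Ioi 0 ×ˢ G)) (hy12 : C12On y (Ioi 0 ×ˢ G))
    (hLx : ∀ p ∈ (Ioi (0:ℝ)) ×ˢ G, Lop a f x p.1 p.2 = 0)
    (hLy : ∀ p ∈ (Ioi (0:ℝ)) ×ˢ G, Lop a f y p.1 p.2 = 0)
    (hinit : ∀ z ∈ G, x 0 z ≤ y 0 z)
    (hbdry : ∀ t ≥ (0:ℝ), ∀ z ∈ frontier G, x t z ≤ y t z) :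
    ∀ t ≥ (0:ℝ), ∀ z ∈ closure G, x t z ≤ y t z := by
  intro t0 ht0 z0 hz0
  by_contra! hlt
  obtain ⟨K, hK, hpar⟩ := hpar
  have hcl : IsCompact (closure G) := hGbdd.isCompact_closure
  have hQ : IsCompact (Icc 0 t0 ×ˢ closure G) := isCompact_Icc.prod hcl
  have hsub : Icc 0 t0 ×ˢ closure G ⊆ Ici 0 ×ˢ closure G :=
    prod_mono Icc_subset_Ici_self subset_rfl
  have hxQ := hxC.mono hsub
  have hyQ := hyC.mono hsub
  obtain ⟨k, hk, hkl⟩ := hlip _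
    ((hQ.image_of_continuousOn hxQ).isBounded.union (hQ.image_of_continuousOn hyQ).isBounded)
  have hc : ContinuousOn (fun p : ℝ × EuclideanSpace ℝ (Fin n) =>
      Real.exp (-k * p.1) * (x p.1 p.2 - y p.1 p.2)) (Icc 0 t0 ×ˢ closure G) :=
    (Continuous.continuousOn (by fun_prop)).mul (hxQ.sub hyQ)
  have hm0 : (t0, z0) ∈ Icc 0 t0 ×ˢ closure G := ⟨⟨ht0, le_rfl⟩, hz0⟩
  obtain ⟨⟨t, z⟩, hp, hmax⟩ := hQ.exists_isMaxOn ⟨_, hm0⟩ hc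
  have hpt : 0 ≤ t := hp.1.1
  have hpt0 : t ≤ t0 := hp.1.2
  have hpz : z ∈ closure G := hp.2
  have hmax' : ∀ s w, 0 ≤ s → s ≤ t0 → w ∈ closure G →
      Real.exp (-k * s) * (x s w - y s w) ≤ Real.exp (-k * t) * (x t z - y t z) :=
    fun s w h1 h2 h3 => hmax (show (s, w) ∈ Icc 0 t0 ×ˢ closure G from ⟨⟨h1, h2⟩, h3⟩)
  have hpos : y t z < x t z := by
    have h1 := hmax' t0 z0 ht0 le_rfl hz0
    have h2 : 0 < Real.exp (-k * t0) * (x t0 z0 - y t0 z0) :=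
      mul_pos (Real.exp_pos _) (by linarith)
    have h3 := (mul_pos_iff_of_pos_left (Real.exp_pos (-k * t))).1 (h2.trans_le h1)
    linarith
  have hzG : z ∈ G := by
    by_contra hz
    have : z ∈ frontier G := by rw [hGopen.frontier_eq]; exact ⟨hpz, hz⟩
    linarith [hbdry t hpt z this]
  have htpos : 0 < t := by
    rcases hpt.eq_or_lt with h | h
    · subst h; linarith [hinit z hzG]
    · exact h
  have hD : ((t, z) : ℝ × EuclideanSpace ℝ (Fin n)) ∈ Ioi (0:ℝ) ×ˢ G := ⟨htpos, hzG⟩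
  obtain ⟨hx1, -, hx2, hx3, -⟩ := hx12
  obtain ⟨hy1, -, hy2, hy3, -⟩ := hy12
  -- time derivative
  have htime : k * (x t z - y t z) ≤ deriv (fun s => x s z) t - deriv (fun s => y s z) t := by
    have he : HasDerivAt (fun s : ℝ => Real.exp (-k * s)) (Real.exp (-k * t) * (-k)) t := by
      simpa using ((hasDerivAt_id t).const_mul (-k)).exp
    have hd := he.mul ((hx1 _ hD).hasDerivAt.sub (hy1 _ hD).hasDerivAt)
    have h0 := left_deriv_nonneg hd htpos
      (fun s hs hst => hmax' s z hs (hst.trans hpt0) hpz)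
    simp only [Pi.sub_apply] at h0
    have h1 : 0 ≤ Real.exp (-k * t) * ((deriv (fun s => x s z) t - deriv (fun s => y s z) t)
      - k * (x t z - y t z)) := by linarith
    have := nonneg_of_mul_nonneg_right h1 (Real.exp_pos _)
    linarith
  -- space derivatives
  let g : EuclideanSpace ℝ (Fin n) → ℝ := fun w => x t w - y t w
  have hGn : G ∈ nhds z := hGopen.mem_nhds hzG
  have hxd : ∀ w ∈ G, DifferentiableAt ℝ (x t) w := fun w hw => hx2 (t, w) ⟨htpos, hw⟩
  have hyd : ∀ w ∈ G, DifferentiableAt ℝ (y t) w := fun w hw => hy2 (t, w) ⟨htpos, hw⟩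
  have hxdd : DifferentiableAt ℝ (fderiv ℝ (x t)) z := hx3 _ hD
  have hydd : DifferentiableAt ℝ (fderiv ℝ (y t)) z := hy3 _ hD
  have hgd : ∀ᶠ w in nhds z, DifferentiableAt ℝ g w := by
    filter_upwards [hGn] with w hw using (hxd w hw).sub (hyd w hw)
  have hgf : fderiv ℝ g =ᶠ[nhds z] fun w => fderiv ℝ (x t) w - fderiv ℝ (y t) w := by
    filter_upwards [hGn] with w hw using fderiv_fun_sub (hxd w hw) (hyd w hw)
  have hgdd : DifferentiableAt ℝ (fderiv ℝ g) z :=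
    (hxdd.sub hydd).congr_of_eventuallyEq hgf
  have hgdd' : fderiv ℝ (fderiv ℝ g) z
      = fderiv ℝ (fderiv ℝ (x t)) z - fderiv ℝ (fderiv ℝ (y t)) z := by
    rw [hgf.fderiv_eq]; exact fderiv_fun_sub hxdd hydd
  have hgmax : IsLocalMax g z := by
    filter_upwards [hGn] with w hw
    have := hmax' t w hpt hpt0 (subset_closure hw)
    exact le_of_mul_le_mul_left this (Real.exp_pos _)
  have hgrad : fderiv ℝ (x t) z = fderiv ℝ (y t) z := by
    have h1 := hgmax.fderiv_eq_zero
    rw [hgf.self_of_nhds] at h1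
    exact sub_eq_zero.1 h1
  have hgr : grad (x t) z = grad (y t) z := by simp only [grad, hgrad]
  have hpd : ∀ u : EuclideanSpace ℝ (Fin n) → ℝ, DifferentiableAt ℝ (fderiv ℝ u) z →
      ∀ i j, pder2 u z i j = fderiv ℝ (fderiv ℝ u) z (edir n j) (edir n i) := by
    intro u hu i j
    have := hu.hasFDerivAt.clm_apply (hasFDerivAt_const (edir n i) z)
    simp only [pder2]
    rw [this.fderiv]
    simp
  have hsymm := second_derivative_symmetric_of_eventually
    (hgd.mono fun w hw => hw.hasFDerivAt) hgdd.hasFDerivAt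
  have htr := trace_nonpos (fun i j => a i j z)
    (fun i j => fderiv ℝ (fderiv ℝ g) z (edir n j) (edir n i))
    (fun ξ => by
      have := hpar z hpz (WithLp.toLp 2 ξ)
      refine le_trans (by positivity) this)
    (fun i j => hsymm _ _)
    (fun ξ => by
      have h := hess_nonpos g z hgd hgdd hgmax (∑ i, ξ i • edir n i)
      simp only [map_sum, map_smul, ContinuousLinearMap.sum_apply, ContinuousLinearMap.smul_apply,
        smul_eq_mul, Finset.mul_sum] at h
      refine le_trans (le_of_eq ?_) h
      refine Finset.sum_congr rfl fun i _ => Finset.sum_congr rfl fun j _ => ?_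
      ring)
  have hsum : ∑ i, ∑ j, a i j z * fderiv ℝ (fderiv ℝ g) z (edir n j) (edir n i)
      = ∑ i, ∑ j, a i j z * pder2 (x t) z i j - ∑ i, ∑ j, a i j z * pder2 (y t) z i j := by
    simp only [← Finset.sum_sub_distrib]
    refine Finset.sum_congr rfl fun i _ => Finset.sum_congr rfl fun j _ => ?_
    rw [hpd _ hxdd, hpd _ hydd, hgdd']
    simp only [ContinuousLinearMap.sub_apply]
    ring
  simp only [hsum] at htr
  have hLx' := hLx _ hD
  have hLy' := hLy _ hD
  simp only [Lop] at hLx' hLy'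
  have hfl := hkl (x t z) (Or.inl ⟨(t, z), hp, rfl⟩) (y t z) (Or.inr ⟨(t, z), hp, rfl⟩) hpos z hzG
    (grad (x t) z)
  rw [← hgr] at hLy'
  linarith

end
end

section
/- Under hypotheses (H1), (H2) and (H3), the boundary-input system is ISS with respect to inputs that are constant in time and space if and only if the transformed system with constant distributed inputs is ISS, i.e. there exist β of class KL and γ of class K such that ‖φ(t, y₀ + c, c) − c‖_p ≤ β(‖y₀‖_p, t) + γ(|c|) for every y₀ ∈ X with y₀ = 0 on ∂G, every constant c ∈ ℝ (identified with the constant function on closure(G) and the constant boundary input) and every t ≥ 0. -/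
open Filter Set MeasureTheory ENNReal

noncomputable section

/-- A boundary input: a bounded continuous function on `ℝ≥0 × ∂G`. -/
def IsBdryInput {n : ℕ} (G : Set (EuclideanSpace ℝ (Fin n)))
    (u : ℝ → EuclideanSpace ℝ (Fin n) → ℝ) : Prop :=
  ContinuousOn (fun q : ℝ × EuclideanSpace ℝ (Fin n) => u q.1 q.2) (Ici 0 ×ˢ frontier G) ∧
  ∃ C : ℝ, ∀ t ≥ (0:ℝ), ∀ z ∈ frontier G, |u t z| ≤ C

/-- The `L^p(G)` norm of a state. -/
def Xnorm {n : ℕ} (G : Set (EuclideanSpace ℝ (Fin n))) (p : ℝ≥0∞)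
    (x : EuclideanSpace ℝ (Fin n) → ℝ) : ℝ :=
  (eLpNorm x p (volume.restrict G)).toReal

/-- The sup-norm `sup_{t ≥ 0, z ∈ ∂G} |u(t,z)|` of a boundary input. -/
def bdryNorm {n : ℕ} (G : Set (EuclideanSpace ℝ (Fin n)))
    (u : ℝ → EuclideanSpace ℝ (Fin n) → ℝ) : ℝ :=
  sSup ((fun q : ℝ × EuclideanSpace ℝ (Fin n) => |u q.1 q.2|) '' (Ici 0 ×ˢ frontier G))

/-- Inputs that are constant in time and space on the boundary. -/
def ConstInputs {n : ℕ} (G : Set (EuclideanSpace ℝ (Fin n))) :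
    Set (ℝ → EuclideanSpace ℝ (Fin n) → ℝ) :=
  {u | ∃ c : ℝ, ∀ t ≥ (0:ℝ), ∀ z ∈ frontier G, u t z = c}

/-- ISS of the boundary-input system with respect to inputs in `S`. -/
def BdryISSwrt {n : ℕ} (G : Set (EuclideanSpace ℝ (Fin n))) (p : ℝ≥0∞)
    (X : Set (EuclideanSpace ℝ (Fin n) → ℝ))
    (A : (EuclideanSpace ℝ (Fin n) → ℝ) → Set (ℝ → EuclideanSpace ℝ (Fin n) → ℝ))
    (φ : (EuclideanSpace ℝ (Fin n) → ℝ) → (ℝ → EuclideanSpace ℝ (Fin n) → ℝ) →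
      ℝ → EuclideanSpace ℝ (Fin n) → ℝ)
    (S : Set (ℝ → EuclideanSpace ℝ (Fin n) → ℝ)) : Prop :=
  ∃ β γ : _, ClassKL β ∧ ClassK γ ∧
    ∀ x₀ ∈ X, ∀ u ∈ A x₀ ∩ S, ∀ t ≥ (0:ℝ),
      Xnorm G p (φ x₀ u t) ≤ β (Xnorm G p x₀) t + γ (bdryNorm G u)

/-- exp-ISS of the boundary-input system with respect to inputs in `S`. -/
def BdryExpISSwrt {n : ℕ} (G : Set (EuclideanSpace ℝ (Fin n))) (p : ℝ≥0∞)
    (X : Set (EuclideanSpace ℝ (Fin n) → ℝ))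
    (A : (EuclideanSpace ℝ (Fin n) → ℝ) → Set (ℝ → EuclideanSpace ℝ (Fin n) → ℝ))
    (φ : (EuclideanSpace ℝ (Fin n) → ℝ) → (ℝ → EuclideanSpace ℝ (Fin n) → ℝ) →
      ℝ → EuclideanSpace ℝ (Fin n) → ℝ)
    (S : Set (ℝ → EuclideanSpace ℝ (Fin n) → ℝ)) : Prop :=
  ∃ M > (0:ℝ), ∃ a > (0:ℝ), ∃ γ : ℝ → ℝ, ClassKInf γ ∧
    ∀ x₀ ∈ X, ∀ u ∈ A x₀ ∩ S, ∀ t ≥ (0:ℝ),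
      Xnorm G p (φ x₀ u t) ≤ M * Real.exp (-a * t) * Xnorm G p x₀ + γ (bdryNorm G u)

open scoped MatrixOrder Matrix in
lemma trace_nonpos_of {n : ℕ} (a H : Fin n → Fin n → ℝ)
    (ha : ∀ ξ : Fin n → ℝ, 0 ≤ ∑ i, ∑ j, a i j * ξ i * ξ j)
    (hsym : ∀ i j, H i j = H j i)
    (hH : ∀ ξ : Fin n → ℝ, ∑ i, ∑ j, ξ i * ξ j * H i j ≤ 0) :
    ∑ i, ∑ j, a i j * H i j ≤ 0 := by
  let M : Matrix (Fin n) (Fin n) ℝ := Matrix.of fun i j => - H i j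
  have hM : M.PosSemidef := by
    refine Matrix.PosSemidef.of_dotProduct_mulVec_nonneg ?_ ?_
    · ext i j
      simp [M, Matrix.conjTranspose_apply, hsym i j]
    · intro x
      have := hH x
      have e : star x ⬝ᵥ M.mulVec x = - ∑ i, ∑ j, x i * x j * H i j := by
        simp only [dotProduct, Matrix.mulVec, M, Matrix.of_apply, Finset.mul_sum, ← Finset.sum_neg_distrib]
        refine Finset.sum_congr rfl fun i _ => Finset.sum_congr rfl fun j _ => ?_
        simp; ring
      rw [e]; linarith
  obtain ⟨B, hB⟩ := CStarAlgebra.nonneg_iff_eq_star_mul_self.1 hM.nonneg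
  have hHB : ∀ i j, H i j = - ∑ k, B k i * B k j := by
    intro i j
    have := congrFun (congrFun hB i) j
    simp [M, Matrix.mul_apply, Matrix.star_apply] at this
    linarith
  have : ∑ i, ∑ j, a i j * H i j = - ∑ k, ∑ i, ∑ j, a i j * B k i * B k j := by
    have e : ∑ k, ∑ i, ∑ j, a i j * B k i * B k j = ∑ i, ∑ j, ∑ k, a i j * B k i * B k j := by
      rw [Finset.sum_comm]
      exact Finset.sum_congr rfl fun i _ => Finset.sum_comm
    rw [e]
    simp only [hHB, ← Finset.sum_neg_distrib, Finset.mul_sum]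
    refine Finset.sum_congr rfl fun i _ => Finset.sum_congr rfl fun j _ =>
      Finset.sum_congr rfl fun k _ => ?_
    ring
  rw [this]
  have : 0 ≤ ∑ k, ∑ i, ∑ j, a i j * B k i * B k j := Finset.sum_nonneg fun k _ => ha (B k)
  linarith

/-- second derivative test along a line -/
lemma second_deriv_nonpos (g g' : ℝ → ℝ) (g'' : ℝ)
    (hg : ∀ᶠ s in nhds (0:ℝ), HasDerivAt g (g' s) s) (hg' : HasDerivAt g' g'' 0)
    (hmax : IsLocalMax g 0) : g'' ≤ 0 := by
  by_contra! hpos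
  have e : deriv g =ᶠ[nhds 0] g' := hg.mono fun s hs => hs.deriv
  have h2 : deriv (deriv g) 0 = g'' := by rw [e.deriv_eq, hg'.deriv]
  have h0 : deriv g 0 = 0 := hmax.deriv_eq_zero
  have hmin : IsLocalMin g 0 := isLocalMin_of_deriv_deriv_pos (by rw [h2]; exact hpos) h0
    hg.self_of_nhds.continuousAt
  have hc : g =ᶠ[nhds 0] fun _ => g 0 := by
    filter_upwards [hmax, hmin] with s h1 h2 using le_antisymm h1 h2
  have : deriv (deriv g) 0 = 0 := by
    rw [hc.deriv.deriv_eq]; simp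
  rw [h2] at this
  linarith

/-- comparison principle -/
lemma compare {n : ℕ} (G : Set (EuclideanSpace ℝ (Fin n)))
    (hGopen : IsOpen G) (hGbdd : Bornology.IsBounded G)
    (a : Fin n → Fin n → EuclideanSpace ℝ (Fin n) → ℝ)
    (hpar : UniformlyParabolic G a)
    (f : EuclideanSpace ℝ (Fin n) → ℝ → EuclideanSpace ℝ (Fin n) → ℝ)
    (hlip : OneSidedLip G f)
    (v w : ℝ → EuclideanSpace ℝ (Fin n) → ℝ)
    (hvc : ContinuousOn (fun q : ℝ × EuclideanSpace ℝ (Fin n) => v q.1 q.2) (Ici 0 ×ˢ closure G))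
    (hwc : ContinuousOn (fun q : ℝ × EuclideanSpace ℝ (Fin n) => w q.1 q.2) (Ici 0 ×ˢ closure G))
    (hv : C12On v (Ioi 0 ×ˢ G)) (hw : C12On w (Ioi 0 ×ˢ G))
    (hLv : ∀ q ∈ (Ioi (0:ℝ)) ×ˢ G, Lop a f v q.1 q.2 = 0)
    (hLw : ∀ q ∈ (Ioi (0:ℝ)) ×ˢ G, Lop a f w q.1 q.2 = 0)
    (h0 : ∀ z ∈ G, v 0 z = w 0 z)
    (hb : ∀ t ≥ (0:ℝ), ∀ z ∈ frontier G, v t z = w t z) :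
    ∀ t ≥ (0:ℝ), ∀ z ∈ G, v t z ≤ w t z := by
  intro T hT z1 hz1
  by_contra! hlt
  have hK : IsCompact (Icc 0 T ×ˢ closure G) := isCompact_Icc.prod hGbdd.isCompact_closure
  have hsub : (Icc 0 T ×ˢ closure G) ⊆ (Ici 0 ×ˢ closure G) :=
    prod_mono Icc_subset_Ici_self subset_rfl
  have hvK := hvc.mono hsub
  have hwK := hwc.mono hsub
  obtain ⟨k, hk, hkl⟩ := hlip _ ((hK.image_of_continuousOn hvK).isBounded.union
    (hK.image_of_continuousOn hwK).isBounded)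
  have hDc : ContinuousOn (fun q : ℝ × EuclideanSpace ℝ (Fin n) =>
      Real.exp (-k * q.1) * (v q.1 q.2 - w q.1 q.2)) (Icc 0 T ×ˢ closure G) := by
    refine ContinuousOn.mul (by fun_prop) (hvK.sub hwK)
  have hmem1 : (T, z1) ∈ Icc 0 T ×ˢ closure G := ⟨⟨hT, le_rfl⟩, subset_closure hz1⟩
  obtain ⟨⟨t0, z0⟩, hq, hmax⟩ := hK.exists_isMaxOn ⟨_, hmem1⟩ hDc
  rw [isMaxOn_iff] at hmax
  have hpos : 0 < Real.exp (-k * t0) * (v t0 z0 - w t0 z0) :=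
    lt_of_lt_of_le (mul_pos (Real.exp_pos _) (sub_pos.2 hlt)) (hmax _ hmem1)
  have hpos' : 0 < v t0 z0 - w t0 z0 := (pos_iff_pos_of_mul_pos hpos).1 (Real.exp_pos _)
  obtain ⟨⟨ht0, ht0T⟩, hz0c⟩ := hq
  simp only at ht0 ht0T hz0c
  have hz0 : z0 ∈ G := by
    by_contra hn
    have : z0 ∈ frontier G := ⟨hz0c, by rwa [hGopen.interior_eq]⟩
    have := hb t0 ht0 z0 this
    linarith
  have ht0' : 0 < t0 := by
    rcases ht0.eq_or_lt with h | h
    · subst h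
      have := h0 z0 hz0
      linarith
    · exact h
  have hnear : ∀ᶠ z in nhds z0, z ∈ G := hGopen.mem_nhds hz0
  have hp0 : (t0, z0) ∈ Ioi (0:ℝ) ×ˢ G := ⟨ht0', hz0⟩
  -- space
  let d : EuclideanSpace ℝ (Fin n) → ℝ := fun z => v t0 z - w t0 z
  have hdmax : ∀ z ∈ G, d z ≤ d z0 := by
    intro z hz
    have := hmax (t0, z) ⟨⟨ht0, ht0T⟩, subset_closure hz⟩
    exact le_of_mul_le_mul_left this (Real.exp_pos _)
  have hdloc : IsLocalMax d z0 := hnear.mono hdmax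
  have hdv : ∀ z ∈ G, DifferentiableAt ℝ (v t0) z := fun z hz => hv.2.2.1 (t0, z) ⟨ht0', hz⟩
  have hdw : ∀ z ∈ G, DifferentiableAt ℝ (w t0) z := fun z hz => hw.2.2.1 (t0, z) ⟨ht0', hz⟩
  have hd1 : ∀ z ∈ G, HasFDerivAt d (fderiv ℝ (v t0) z - fderiv ℝ (w t0) z) z := fun z hz =>
    (hdv z hz).hasFDerivAt.sub (hdw z hz).hasFDerivAt
  have hv2 := (hv.2.2.2.1 _ hp0).hasFDerivAt
  have hw2 := (hw.2.2.2.1 _ hp0).hasFDerivAt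
  simp only at hv2 hw2
  set Hv := fderiv ℝ (fun w => fderiv ℝ (v t0) w) z0 with hHv
  set Hw := fderiv ℝ (fun z => fderiv ℝ (w t0) z) z0 with hHw
  have hd2 : HasFDerivAt (fun z => fderiv ℝ (v t0) z - fderiv ℝ (w t0) z) (Hv - Hw) z0 :=
    hv2.sub hw2
  have hgrad0 : fderiv ℝ (v t0) z0 = fderiv ℝ (w t0) z0 := by
    have := hdloc.hasFDerivAt_eq_zero (hd1 z0 hz0)
    exact sub_eq_zero.1 this
  have hgrad : grad (v t0) z0 = grad (w t0) z0 := by simp only [grad, hgrad0]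
  have hsymm : ∀ x y, (Hv - Hw) x y = (Hv - Hw) y x :=
    fun x y => second_derivative_symmetric_of_eventually (hnear.mono hd1) hd2 x y
  have hneg : ∀ x, (Hv - Hw) x x ≤ 0 := by
    intro x
    have hline : ∀ s : ℝ, HasDerivAt (fun s : ℝ => z0 + s • x) x s := fun s => by
      simpa using ((hasDerivAt_id s).smul_const x).const_add z0
    have hline0 : z0 + (0:ℝ) • x = z0 := by simp
    have hcont : Tendsto (fun s : ℝ => z0 + s • x) (nhds 0) (nhds z0) := by
      have := (hline 0).continuousAt.tendsto
      rwa [hline0] at this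
    refine second_deriv_nonpos (fun s : ℝ => d (z0 + s • x))
      (fun s => (fderiv ℝ (v t0) (z0 + s • x) - fderiv ℝ (w t0) (z0 + s • x)) x) _ ?_ ?_ ?_
    · filter_upwards [hcont.eventually hnear] with s hs
      exact (hd1 _ hs).comp_hasDerivAt s (hline s)
    · have h3 : HasFDerivAt (fun z => fderiv ℝ (v t0) z - fderiv ℝ (w t0) z) (Hv - Hw)
        (z0 + (0:ℝ) • x) := by rw [hline0]; exact hd2
      have h4 := h3.comp_hasDerivAt (0:ℝ) (hline 0)
      have h5 := h4.clm_apply (hasDerivAt_const (0:ℝ) x)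
      simpa using h5
    · have : ∀ᶠ s in nhds (0:ℝ), d (z0 + s • x) ≤ d z0 := hcont.eventually hdloc
      refine this.mono fun s hs => ?_
      simpa using hs
  have hpv : ∀ i j, pder2 (v t0) z0 i j = Hv (edir n j) (edir n i) := by
    intro i j
    have := (hv2.clm_apply (hasFDerivAt_const (edir n i) z0)).fderiv
    simp only [pder2, this]
    simp
  have hpw : ∀ i j, pder2 (w t0) z0 i j = Hw (edir n j) (edir n i) := by
    intro i j
    have := (hw2.clm_apply (hasFDerivAt_const (edir n i) z0)).fderiv
    simp only [pder2, this]
    simp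
  have htr : ∑ i, ∑ j, a i j z0 * (Hv - Hw) (edir n j) (edir n i) ≤ 0 := by
    refine trace_nonpos_of (fun i j => a i j z0) (fun i j => (Hv - Hw) (edir n j) (edir n i))
      ?_ (fun i j => hsymm _ _) ?_
    · intro ξ
      obtain ⟨K, hK, hKp⟩ := hpar
      refine le_trans ?_ (hKp z0 hz0c (WithLp.toLp 2 ξ))
      positivity
    · intro ξ
      have := hneg (∑ i, ξ i • edir n i)
      refine le_trans (le_of_eq ?_) this
      simp only [map_sum, map_smul, sum_apply, smul_apply,
        Finset.smul_sum, smul_eq_mul, Finset.mul_sum]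
      refine Finset.sum_congr rfl fun i _ => Finset.sum_congr rfl fun j _ => ?_
      ring
  have hdiff : ∑ i, ∑ j, a i j z0 * (Hv - Hw) (edir n j) (edir n i) =
      ∑ i, ∑ j, a i j z0 * pder2 (v t0) z0 i j - ∑ i, ∑ j, a i j z0 * pder2 (w t0) z0 i j := by
    simp only [hpv, hpw, ← Finset.sum_sub_distrib]
    refine Finset.sum_congr rfl fun i _ => Finset.sum_congr rfl fun j _ => ?_
    simp; ring
  -- time
  have htv := (hv.1 _ hp0).hasDerivAt
  have htw := (hw.1 _ hp0).hasDerivAt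
  simp only at htv htw
  have hexp : HasDerivAt (fun s => Real.exp (-k * s)) (Real.exp (-k * t0) * (-k)) t0 := by
    simpa using ((hasDerivAt_id t0).const_mul (-k)).exp
  have hD := hexp.mul (htv.sub htw)
  have hDnn := hD.hasDerivWithinAt (s := Iio t0)
  have hslope : 0 ≤ Real.exp (-k * t0) * (-k) * (v t0 z0 - w t0 z0) + Real.exp (-k * t0) *
      (deriv (fun s => v s z0) t0 - deriv (fun s => w s z0) t0) := by
    have hlim := (hasDerivWithinAt_iff_tendsto_slope' (by simp)).1 hDnn
    refine ge_of_tendsto hlim ?_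
    have : ∀ᶠ s in nhdsWithin t0 (Iio t0), s ∈ Ioo 0 t0 := Ioo_mem_nhdsLT ht0'
    filter_upwards [this] with s hs
    rw [slope_def_field]
    have := hmax (s, z0) ⟨⟨hs.1.le, hs.2.le.trans ht0T⟩, hz0c⟩
    refine div_nonneg_of_nonpos ?_ (by linarith [hs.2])
    simpa using this
  have hslope' : 0 ≤ Real.exp (-k * t0) * ((deriv (fun s => v s z0) t0 - deriv (fun s => w s z0) t0) -
      k * (v t0 z0 - w t0 z0)) := by linarith
  have hge := nonneg_of_mul_nonneg_right hslope' (Real.exp_pos _)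
  have e1 := hLv _ hp0
  have e2 := hLw _ hp0
  simp only [Lop] at e1 e2
  have hm : (t0, z0) ∈ Icc 0 T ×ˢ closure G := ⟨⟨ht0, ht0T⟩, hz0c⟩
  have hf' := hkl (v t0 z0) (Or.inl ⟨_, hm, rfl⟩) (w t0 z0) (Or.inr ⟨_, hm, rfl⟩)
    (by linarith) z0 hz0 (grad (v t0) z0)
  rw [← hgrad] at e2
  linarith

lemma memLp_of_cont {n : ℕ} (G : Set (EuclideanSpace ℝ (Fin n)))
    (hGopen : IsOpen G) (hGbdd : Bornology.IsBounded G) (p : ℝ≥0∞)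
    (x : EuclideanSpace ℝ (Fin n) → ℝ) (hx : ContinuousOn x (closure G)) :
    MemLp x p (volume.restrict G) := by
  have : IsFiniteMeasure (volume.restrict G) := ⟨by
    rw [Measure.restrict_apply_univ]; exact hGbdd.measure_lt_top⟩
  obtain ⟨C, hC⟩ := hGbdd.isCompact_closure.exists_bound_of_continuousOn hx
  refine MemLp.of_bound ((hx.mono subset_closure).aestronglyMeasurable hGopen.measurableSet) C ?_
  refine (ae_restrict_iff' hGopen.measurableSet).2 (ae_of_all _ fun z hz => hC z (subset_closure hz))

lemma Xnorm_add {n : ℕ} (G : Set (EuclideanSpace ℝ (Fin n)))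
    (hGopen : IsOpen G) (hGbdd : Bornology.IsBounded G) (p : ℝ≥0∞) (hp : 1 ≤ p)
    (x y : EuclideanSpace ℝ (Fin n) → ℝ) (hx : ContinuousOn x (closure G))
    (hy : ContinuousOn y (closure G)) :
    Xnorm G p (fun z => x z + y z) ≤ Xnorm G p x + Xnorm G p y := by
  have mx := memLp_of_cont G hGopen hGbdd p x hx
  have my := memLp_of_cont G hGopen hGbdd p y hy
  unfold Xnorm
  rw [← ENNReal.toReal_add mx.eLpNorm_ne_top my.eLpNorm_ne_top]
  exact ENNReal.toReal_mono (ENNReal.add_ne_top.2 ⟨mx.eLpNorm_ne_top, my.eLpNorm_ne_top⟩)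
    (eLpNorm_add_le mx.1 my.1 hp)

lemma Xnorm_const {n : ℕ} (G : Set (EuclideanSpace ℝ (Fin n))) (p : ℝ≥0∞) (c : ℝ) :
    Xnorm G p (fun _ => c) = |c| * Xnorm G p (fun _ => 1) := by
  unfold Xnorm
  have : (fun _ : EuclideanSpace ℝ (Fin n) => c) = c • (fun _ => (1:ℝ)) := by ext; simp
  rw [this, eLpNorm_const_smul, ENNReal.toReal_mul]
  simp

lemma Xnorm_congr {n : ℕ} (G : Set (EuclideanSpace ℝ (Fin n))) (hGopen : IsOpen G) (p : ℝ≥0∞)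
    (x y : EuclideanSpace ℝ (Fin n) → ℝ) (h : ∀ z ∈ G, x z = y z) :
    Xnorm G p x = Xnorm G p y := by
  unfold Xnorm
  congr 1
  exact eLpNorm_congr_ae ((ae_restrict_iff' hGopen.measurableSet).2 (ae_of_all _ h))

lemma Xnorm_nonneg {n : ℕ} (G : Set (EuclideanSpace ℝ (Fin n))) (p : ℝ≥0∞)
    (x : EuclideanSpace ℝ (Fin n) → ℝ) : 0 ≤ Xnorm G p x := ENNReal.toReal_nonneg

lemma ClassKL_two (β : ℝ → ℝ → ℝ) (h : ClassKL β) : ClassKL fun r t => β (2 * r) t := by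
  obtain ⟨h1, h2, h3⟩ := h
  refine ⟨?_, ?_, ?_⟩
  · refine h1.comp (f := fun q : ℝ × ℝ => (2 * q.1, q.2)) (by fun_prop) ?_
    rintro ⟨r, t⟩ ⟨hr, ht⟩
    simp only [mem_Ici] at hr ht
    exact ⟨by simpa using hr, ht⟩
  · intro t ht
    obtain ⟨c, m, z⟩ := h2 t ht
    refine ⟨c.comp (f := fun r : ℝ => 2 * r) (by fun_prop) (fun r hr => ?_), fun r hr s hs hrs => ?_, by simpa using z⟩
    · simpa using hr
    · exact m (by simpa using hr) (by simpa using hs) (by linarith)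
  · intro r hr
    exact h3 (2 * r) (by linarith)

lemma ClassK_new (β γ : ℝ → ℝ) (hβ : ClassK β) (hγ : ClassK γ) (C : ℝ) (hC : 0 ≤ C) :
    ClassK fun s => β (2 * (s * C)) + (γ s + s * C) := by
  obtain ⟨c, m, z⟩ := hβ
  obtain ⟨c', m', z'⟩ := hγ
  have hn : ∀ s : ℝ, 0 ≤ s → 0 ≤ 2 * (s * C) := fun s hs => by positivity
  refine ⟨?_, ?_, by simp [z, z']⟩
  · refine (c.comp (f := fun s : ℝ => 2 * (s * C)) (by fun_prop) (fun s hs => hn s hs)).add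
      (c'.add (by fun_prop))
  · intro r hr s hs hrs
    have h1 : r * C ≤ s * C := mul_le_mul_of_nonneg_right hrs.le hC
    have h2 := m.monotoneOn (hn r hr) (hn s hs) (by linarith)
    have h3 := m' hr hs hrs
    simp only
    linarith

lemma KL_split (β : ℝ → ℝ → ℝ) (h : ClassKL β) (q r s t : ℝ) (hq : 0 ≤ q) (hr : 0 ≤ r) (hs : 0 ≤ s)
    (ht : 0 ≤ t) (hqrs : q ≤ r + s) : β q t ≤ β (2 * r) t + β (2 * s) 0 := by
  obtain ⟨h1, h2, h3⟩ := h
  obtain ⟨_, m, z⟩ := h2 t ht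
  have nn : ∀ x, 0 ≤ x → 0 ≤ β x t := fun x hx => by
    have := m.monotoneOn (show (0:ℝ) ∈ Ici 0 by simp) hx hx
    simp only at this z; linarith
  have hdec : ∀ x, 0 ≤ x → β x t ≤ β x 0 := fun x hx => by
    rcases hx.eq_or_lt with h | h
    · subst h
      have := (h2 0 le_rfl).2.2
      simp only at this z; linarith
    · exact (h3 x h).1.antitoneOn (show (0:ℝ) ∈ Ici 0 by simp) ht ht
  have h2r : (0:ℝ) ≤ 2 * r := by linarith
  have h2s : (0:ℝ) ≤ 2 * s := by linarith
  have := nn _ h2r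
  have := nn _ h2s
  have := hdec _ h2s
  rcases le_total r s with hle | hle
  · have := m.monotoneOn hq h2s (by linarith)
    linarith
  · have := m.monotoneOn hq h2r (by linarith)
    linarith

/-- Under (H1), (H2), (H3), the boundary-input parabolic system is ISS
with respect to inputs that are constant in time and space iff the transformed system with
constant distributed inputs is ISS: there are `β ∈ KL`, `γ ∈ K` with
`‖φ(t, y₀ + c, c) − c‖_p ≤ β(‖y₀‖_p, t) + γ(|c|)` for all `y₀ ∈ X` vanishing on `∂G`,
all constants `c ∈ ℝ` and all `t ≥ 0`. -/
theorem stmt10 {n : ℕ} (G : Set (EuclideanSpace ℝ (Fin n)))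
    (hGne : G.Nonempty) (hGopen : IsOpen G) (hGbdd : Bornology.IsBounded G)
    (p : ℝ≥0∞) (hp : 1 ≤ p)
    (a : Fin n → Fin n → EuclideanSpace ℝ (Fin n) → ℝ)
    (ha : ∀ i j, ContinuousOn (a i j) (closure G))
    (hpar : UniformlyParabolic G a)
    (f : EuclideanSpace ℝ (Fin n) → ℝ → EuclideanSpace ℝ (Fin n) → ℝ)
    (hf : ContinuousOn (fun q : EuclideanSpace ℝ (Fin n) × ℝ × EuclideanSpace ℝ (Fin n) =>
      f q.1 q.2.1 q.2.2)
      ((closure G) ×ˢ (univ : Set ℝ) ×ˢ (univ : Set (EuclideanSpace ℝ (Fin n)))))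
    -- Hypothesis (H2)
    (hlip : OneSidedLip G f)
    (hfdiff : ∀ z ∈ closure G,
      ContDiff ℝ 1 fun q : ℝ × EuclideanSpace ℝ (Fin n) => f z q.1 q.2)
    (X : Set (EuclideanSpace ℝ (Fin n) → ℝ))
    (A : (EuclideanSpace ℝ (Fin n) → ℝ) → Set (ℝ → EuclideanSpace ℝ (Fin n) → ℝ))
    (φ : (EuclideanSpace ℝ (Fin n) → ℝ) → (ℝ → EuclideanSpace ℝ (Fin n) → ℝ) →
      ℝ → EuclideanSpace ℝ (Fin n) → ℝ)
    -- Hypothesis (H1): the state space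
    (hXcont : ∀ x ∈ X, ContinuousOn x (closure G))
    (hXconst : ∀ c : ℝ, (fun _ => c) ∈ X)
    (hXadd : ∀ x ∈ X, ∀ y ∈ X, (fun z => x z + y z) ∈ X)
    (hXsmul : ∀ c : ℝ, ∀ x ∈ X, (fun z => c * x z) ∈ X)
    -- Hypothesis (H1): admissible inputs
    (hAne : ∀ x₀ ∈ X, (∃ c : ℝ, ∀ z ∈ frontier G, x₀ z = c) → (A x₀).Nonempty)
    (hAmem : ∀ x₀ ∈ X, ∀ u ∈ A x₀, IsBdryInput G u ∧ ∀ z ∈ frontier G, u 0 z = x₀ z)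
    (hAconst : ∀ x₀ ∈ X, ∀ c : ℝ, (∀ z ∈ frontier G, x₀ z = c) →
      ∀ u : ℝ → EuclideanSpace ℝ (Fin n) → ℝ, IsBdryInput G u →
        (∀ t ≥ (0:ℝ), ∀ z ∈ frontier G, u t z = c) → u ∈ A x₀)
    -- Hypothesis (H1): `φ` yields classical solutions with time-slices in `X`
    (hφ : ∀ x₀ ∈ X, ∀ u ∈ A x₀,
      ContinuousOn (fun q : ℝ × EuclideanSpace ℝ (Fin n) => φ x₀ u q.1 q.2)
        (Ici 0 ×ˢ closure G) ∧
      C12On (φ x₀ u) (Ioi 0 ×ˢ G) ∧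
      (∀ q ∈ (Ioi (0:ℝ)) ×ˢ G, Lop a f (φ x₀ u) q.1 q.2 = 0) ∧
      (∀ z ∈ G, φ x₀ u 0 z = x₀ z) ∧
      (∀ t ≥ (0:ℝ), ∀ z ∈ frontier G, φ x₀ u t z = u t z) ∧
      (∀ t ≥ (0:ℝ), φ x₀ u t ∈ X))
    -- Hypothesis (H3)
    (hH3 : ∀ δ > (0:ℝ), ∀ c : ℝ, ∀ x ∈ X, ∃ k : EuclideanSpace ℝ (Fin n) → ℝ,
      ContinuousOn k (closure G) ∧ (∀ z ∈ closure G, k z ∈ Icc (0:ℝ) 1) ∧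
      (∀ z ∈ frontier G, k z = 1) ∧
      (∀ z ∈ closure G, δ ≤ Metric.infDist z (frontier G) → k z = 0) ∧
      (fun z => (1 - k z) * x z + c * k z) ∈ X)
    :
    BdryISSwrt G p X A φ (ConstInputs G) ↔
      (∃ β γ : _, ClassKL β ∧ ClassK γ ∧
        ∀ y₀ ∈ X, (∀ z ∈ frontier G, y₀ z = 0) → ∀ c : ℝ, ∀ t ≥ (0:ℝ),
          Xnorm G p (fun z => φ (fun w => y₀ w + c) (fun _ _ => c) t z - c) ≤
            β (Xnorm G p y₀) t + γ |c|) := by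
  have hC := Xnorm_nonneg G p (fun _ => (1:ℝ))
  set C := Xnorm G p (fun _ => (1:ℝ)) with hCdef
  have hconstIn : ∀ c : ℝ, IsBdryInput G (fun _ _ => c) := fun c =>
    ⟨continuousOn_const, |c|, fun _ _ _ _ => le_rfl⟩
  have hcc : ∀ c : ℝ, ContinuousOn (fun _ : EuclideanSpace ℝ (Fin n) => c) (closure G) :=
    fun c => continuousOn_const
  constructor
  · rintro ⟨β, γ, hβ, hγ, hiss⟩
    refine ⟨fun r t => β (2 * r) t, fun s => β (2 * (s * C)) 0 + (γ s + s * C), ClassKL_two β hβ,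
      ClassK_new (fun s => β s 0) γ (hβ.2.1 0 le_rfl) hγ C hC, ?_⟩
    intro y₀ hy hy0 c t ht
    have hx : (fun w => y₀ w + c) ∈ X := hXadd y₀ hy _ (hXconst c)
    have hu : (fun _ _ => c) ∈ A (fun w => y₀ w + c) :=
      hAconst _ hx c (fun z hz => by simp [hy0 z hz]) _ (hconstIn c) (fun _ _ _ _ => rfl)
    have h1 := hiss _ hx (fun _ _ => c) ⟨hu, c, fun _ _ _ _ => rfl⟩ t ht
    have hs := hXcont _ ((hφ _ hx _ hu).2.2.2.2.2 t ht)
    have h2 := Xnorm_add G hGopen hGbdd p hp _ _ hs (hcc (-c))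
    have h3 := Xnorm_add G hGopen hGbdd p hp _ _ (hXcont _ hy) (hcc c)
    rw [Xnorm_const, ← hCdef] at h2 h3
    rw [abs_neg] at h2
    have h4 := KL_split β hβ _ _ _ t (Xnorm_nonneg G p _) (Xnorm_nonneg G p y₀)
      (mul_nonneg (abs_nonneg c) hC) ht h3
    have hbn : 0 ≤ bdryNorm G (fun _ _ => c) := by
      refine Real.sSup_nonneg ?_
      rintro _ ⟨q, _, rfl⟩
      exact abs_nonneg _
    have hb : bdryNorm G (fun _ _ => c) ≤ |c| := by
      refine Real.sSup_le ?_ (abs_nonneg c)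
      rintro _ ⟨q, _, rfl⟩
      exact le_rfl
    have h5 := hγ.2.1.monotoneOn hbn (abs_nonneg c) hb
    simp only [sub_eq_add_neg]
    linarith
  · rintro ⟨β, γ, hβ, hγ, hiss⟩
    refine ⟨fun r t => β (2 * r) t, fun s => β (2 * (s * C)) 0 + (γ s + s * C), ClassKL_two β hβ,
      ClassK_new (fun s => β s 0) γ (hβ.2.1 0 le_rfl) hγ C hC, ?_⟩
    rintro x₀ hx u ⟨hu, hcu⟩ t ht
    obtain ⟨c, hc, hbc⟩ : ∃ c : ℝ, (∀ t ≥ (0:ℝ), ∀ z ∈ frontier G, u t z = c) ∧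
        bdryNorm G u = |c| := by
      obtain ⟨c, hc⟩ := hcu
      rcases (frontier G).eq_empty_or_nonempty with he | ⟨z, hz⟩
      · exact ⟨0, by simp [he], by simp [bdryNorm, he]⟩
      · refine ⟨c, hc, ?_⟩
        have : (fun q : ℝ × EuclideanSpace ℝ (Fin n) => |u q.1 q.2|) '' (Ici 0 ×ˢ frontier G)
            = {|c|} := by
          ext r
          constructor
          · rintro ⟨q, hq, rfl⟩
            simp [hc q.1 hq.1 q.2 hq.2]
          · rintro rfl
            exact ⟨(0, z), ⟨by simp, hz⟩, by simp [hc 0 le_rfl z hz]⟩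
        rw [bdryNorm, this, csSup_singleton]
    have hx0c : ∀ z ∈ frontier G, x₀ z = c := fun z hz => by
      rw [← (hAmem x₀ hx u hu).2 z hz, hc 0 le_rfl z hz]
    have hu' : (fun _ _ => c) ∈ A x₀ := hAconst _ hx c hx0c _ (hconstIn c) (fun _ _ _ _ => rfl)
    obtain ⟨v1, v2, v3, v4, v5, v6⟩ := hφ _ hx _ hu
    obtain ⟨w1, w2, w3, w4, w5, w6⟩ := hφ _ hx _ hu'
    have heq : ∀ z ∈ G, φ x₀ u t z = φ x₀ (fun _ _ => c) t z := by
      intro z hz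
      have hi : ∀ z ∈ G, φ x₀ u 0 z = φ x₀ (fun _ _ => c) 0 z := fun z hz => by
        rw [v4 z hz, w4 z hz]
      have hbd : ∀ t ≥ (0:ℝ), ∀ z ∈ frontier G, φ x₀ u t z = φ x₀ (fun _ _ => c) t z :=
        fun t ht z hz => by rw [v5 t ht z hz, w5 t ht z hz, hc t ht z hz]
      exact le_antisymm
        (compare G hGopen hGbdd a hpar f hlip _ _ v1 w1 v2 w2 v3 w3 hi hbd t ht z hz)
        (compare G hGopen hGbdd a hpar f hlip _ _ w1 v1 w2 v2 w3 v3 (fun z hz => (hi z hz).symm)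
          (fun t ht z hz => (hbd t ht z hz).symm) t ht z hz)
    rw [Xnorm_congr G hGopen p _ _ heq, hbc]
    have hy : (fun z => x₀ z + -c) ∈ X := hXadd x₀ hx _ (hXconst (-c))
    have h1 := hiss _ hy (fun z hz => by simp [hx0c z hz]) c t ht
    simp only [neg_add_cancel_right] at h1
    have hs := hXcont _ (w6 t ht)
    have h2 := Xnorm_add G hGopen hGbdd p hp (fun z => φ x₀ (fun _ _ => c) t z - c) _
      (hs.sub (hcc c)) (hcc c)
    have h3 := Xnorm_add G hGopen hGbdd p hp _ _ (hXcont _ hx) (hcc (-c))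
    rw [Xnorm_const, ← hCdef] at h2 h3
    rw [abs_neg] at h3
    simp only [sub_add_cancel] at h2
    have h4 := KL_split β hβ _ _ _ t (Xnorm_nonneg G p _) (Xnorm_nonneg G p x₀)
      (mul_nonneg (abs_nonneg c) hC) ht h3
    linarith

end
end
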